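/- There is a constant C, depending only on ψ and q, such that for every pair (q,r) with 4 ≤ q < ∞, 2 ≤ r ≤ ∞ and 1/q = (1/2)(1/2 − 1/r), every k ≥ 1 and every h ∈ (0,1]: ‖u_k‖_{L^q(ℝ_t; L^r(Ω))} ≤ C h^{−β} ‖u_k(0,·)‖_{L²(Ω)}, where β = 2(1/2 − 1/r) − 1/q. In particular gallery modes satisfy the free-space Strichartz estimates of ℝ² with a constant uniform in the gallery-mode index k. -/

import Mathlib

open Real Complex Filter MeasureTheory ENNReal

/-- The normalized eigenfunctions
`e_k(x,θ) = θ^{1/3} Ai(θ^{2/3}x − ω_k) / (∫₀^∞ Ai(x'−ω_k)² dx')^{1/2}`. -/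
noncomputable def ek (Ai : ℂ → ℂ) (ω : ℕ → ℝ) (k : ℕ) (θ x : ℝ) : ℂ :=
  ((θ ^ ((1:ℝ)/3) : ℝ) : ℂ) * Ai ((θ ^ ((2:ℝ)/3) * x - ω k : ℝ)) /
    ((Real.sqrt (∫ x' in Set.Ioi (0:ℝ), (Ai ((x' - ω k : ℝ))).re ^ 2) : ℝ) : ℂ)

/-- The eigenvalues `λ_k(θ) = θ² + ω_k θ^{4/3}`. -/
noncomputable def lamk (ω : ℕ → ℝ) (k : ℕ) (θ : ℝ) : ℝ :=
  θ ^ 2 + ω k * θ ^ ((4:ℝ)/3)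

/-- The `k`-th gallery mode
`u_k(t,x,y) = (1/h) ∫ e^{it√(λ_k(η/h))} e^{iyη/h} ψ(η) e_k(x,η/h) dη`. -/
noncomputable def galleryMode (Ai : ℂ → ℂ) (ω : ℕ → ℝ) (ψ : ℝ → ℝ)
    (k : ℕ) (h t x y : ℝ) : ℂ :=
  ((1/h : ℝ) : ℂ) * ∫ η : ℝ,
    Complex.exp (Complex.I * ((t * Real.sqrt (lamk ω k (η/h)) : ℝ) : ℂ)) *
    Complex.exp (Complex.I * ((y * η / h : ℝ) : ℂ)) *
    ((ψ η : ℝ) : ℂ) * ek Ai ω k (η/h) x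

/-- The Lebesgue measure on the model domain `Ω = (0,∞) × ℝ`. -/
noncomputable def μΩ : MeasureTheory.Measure (ℝ × ℝ) :=
  MeasureTheory.volume.restrict (Set.Ioi (0:ℝ) ×ˢ (Set.univ : Set ℝ))

/-- The corrected WKB energy of a solution of `y'' = -s y`. -/
noncomputable def wkbEnergy (y y' : ℝ → ℝ) (s : ℝ) : ℝ :=
  y' s ^ 2 / √s + √s * y s ^ 2 + y s * y' s / (2 * √s ^ 3)

theorem hasDerivAt_wkbEnergy {y y' : ℝ → ℝ} (hy : ∀ s, HasDerivAt y (y' s) s)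
    (hy' : ∀ s, HasDerivAt y' (-(s * y s)) s) {s : ℝ} (hs : 0 < s) :
    HasDerivAt (wkbEnergy y y') (-(3 / 4) * (y s * y' s) / √s ^ 5) s := by
  have hr : 0 < √s := Real.sqrt_pos.2 hs
  have hsq : √s ^ 2 = s := Real.sq_sqrt hs.le
  have h1 := Real.hasDerivAt_sqrt hs.ne'
  have h := ((((hy' s).pow 2).div h1 hr.ne').add (h1.mul ((hy s).pow 2))).add
    (((hy s).mul (hy' s)).div ((h1.pow 3).const_mul 2) (mul_pos two_pos (pow_pos hr 3)).ne')
  refine h.congr_deriv ?_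
  simp only [Pi.mul_apply, Pi.pow_apply]
  generalize √s = r at *
  subst hsq
  field_simp
  ring

theorem abs_wkbEnergy_bounds {y y' : ℝ → ℝ} {s : ℝ} (hs : 1 ≤ s) :
    |y s * y' s| ≤ (y' s ^ 2 / √s + √s * y s ^ 2) / 2 ∧
    3 / 4 * (y' s ^ 2 / √s + √s * y s ^ 2) ≤ wkbEnergy y y' s ∧
    wkbEnergy y y' s ≤ 5 / 4 * (y' s ^ 2 / √s + √s * y s ^ 2) := by
  have hr : 1 ≤ √s := Real.one_le_sqrt.2 hs
  unfold wkbEnergy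
  generalize √s = r at *
  generalize y s = a at *
  generalize y' s = b at *
  have hr0 : 0 < r := by linarith
  have key : |a * b| ≤ (b ^ 2 / r + r * a ^ 2) / 2 := by
    have h1 : 0 ≤ (b - r * a) ^ 2 / r := by positivity
    have h2 : 0 ≤ (b + r * a) ^ 2 / r := by positivity
    have e1 : (b - r * a) ^ 2 / r = b ^ 2 / r + r * a ^ 2 - 2 * (a * b) := by field_simp; ring
    have e2 : (b + r * a) ^ 2 / r = b ^ 2 / r + r * a ^ 2 + 2 * (a * b) := by field_simp; ring
    rw [abs_le]; constructor <;> linarith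
  have h3 : |a * b / (2 * r ^ 3)| ≤ |a * b| / 2 := by
    rw [abs_div, abs_of_pos (by positivity : 0 < 2 * r ^ 3)]
    apply div_le_div_of_nonneg_left (abs_nonneg _) (by norm_num)
    have := one_le_pow₀ hr (n := 3)
    linarith
  have := abs_le.1 h3
  exact ⟨key, by linarith [this.1], by linarith [this.2]⟩

theorem abs_deriv_wkbEnergy_le {y y' : ℝ → ℝ} {s : ℝ} (hs : 1 ≤ s) :
    |-(3 / 4) * (y s * y' s) / √s ^ 5| ≤ wkbEnergy y y' s / s ^ 2 := by
  obtain ⟨h1, h2, -⟩ := abs_wkbEnergy_bounds (y := y) (y' := y') hs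
  have hr : 1 ≤ √s := Real.one_le_sqrt.2 hs
  have hsq : √s ^ 2 = s := Real.sq_sqrt (by linarith)
  have h5 : s ^ 2 ≤ √s ^ 5 := by
    nth_rewrite 1 [← hsq]
    rw [← pow_mul]
    exact pow_le_pow_right₀ hr (by norm_num)
  rw [abs_div, abs_mul, abs_of_pos (by positivity : 0 < √s ^ 5)]
  apply div_le_div₀ _ _ (by positivity) h5
  · have := (abs_nonneg _).trans h1
    linarith
  · rw [show |(-(3 / 4) : ℝ)| = 3 / 4 by norm_num [abs_of_pos]]
    have := (abs_nonneg _).trans h1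
    linarith

theorem wkbEnergy_comparable {y y' : ℝ → ℝ} (hy : ∀ s, HasDerivAt y (y' s) s)
    (hy' : ∀ s, HasDerivAt y' (-(s * y s)) s) {s : ℝ} (hs : 1 ≤ s) :
    Real.exp (-1) * wkbEnergy y y' 1 ≤ wkbEnergy y y' s ∧
    wkbEnergy y y' s ≤ Real.exp 1 * wkbEnergy y y' 1 := by
  have hinv : ∀ {s : ℝ}, 1 ≤ s → HasDerivAt (fun s : ℝ => s⁻¹) (-(s ^ 2)⁻¹) s := fun h =>
    hasDerivAt_inv (by linarith)
  have hpos : 0 ≤ wkbEnergy y y' s := by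
    obtain ⟨h1, h2, -⟩ := abs_wkbEnergy_bounds (y := y) (y' := y') hs
    have := (abs_nonneg _).trans h1
    linarith
  have hexp : ∀ (c : ℝ) {s : ℝ}, 1 ≤ s → HasDerivAt
      (fun s => wkbEnergy y y' s * Real.exp (c * s⁻¹))
      ((-(3 / 4) * (y s * y' s) / √s ^ 5 - c * (wkbEnergy y y' s / s ^ 2)) *
        Real.exp (c * s⁻¹)) s := by
    intro c s h
    refine ((hasDerivAt_wkbEnergy hy hy' (by linarith)).mul
      (((hinv h).const_mul c).exp)).congr_deriv ?_
    ring
  have hmono : MonotoneOn (fun s => wkbEnergy y y' s * Real.exp (-1 * s⁻¹)) (Set.Ici 1) := by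
    refine monotoneOn_of_hasDerivWithinAt_nonneg (convex_Ici 1)
      (fun x hx => (hexp (-1) hx).continuousAt.continuousWithinAt)
      (fun x hx => (hexp (-1) (interior_subset hx)).hasDerivWithinAt) ?_
    intro x hx
    have := abs_le.1 (abs_deriv_wkbEnergy_le (y := y) (y' := y') (s := x) (interior_subset hx))
    exact mul_nonneg (by linarith [this.1]) (Real.exp_pos _).le
  have hanti : AntitoneOn (fun s => wkbEnergy y y' s * Real.exp (1 * s⁻¹)) (Set.Ici 1) := by
    refine antitoneOn_of_hasDerivWithinAt_nonpos (convex_Ici 1)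
      (fun x hx => (hexp 1 hx).continuousAt.continuousWithinAt)
      (fun x hx => (hexp 1 (interior_subset hx)).hasDerivWithinAt) ?_
    intro x hx
    have := abs_le.1 (abs_deriv_wkbEnergy_le (y := y) (y' := y') (s := x) (interior_subset hx))
    exact mul_nonpos_of_nonpos_of_nonneg (by linarith [this.2]) (Real.exp_pos _).le
  have h1 := hmono (Set.self_mem_Ici) (Set.mem_Ici.2 hs) hs
  have h2 := hanti (Set.self_mem_Ici) (Set.mem_Ici.2 hs) hs
  have hi : 0 ≤ s⁻¹ := by positivity
  simp only [inv_one, mul_one, one_mul] at h1 h2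
  constructor
  · calc _ = wkbEnergy y y' 1 * Real.exp (-1) := mul_comm _ _
      _ ≤ _ := h1
      _ ≤ wkbEnergy y y' s * 1 := by
        gcongr
        exact Real.exp_le_one_iff.2 (by linarith)
      _ = _ := mul_one _
  · calc wkbEnergy y y' s = wkbEnergy y y' s * 1 := (mul_one _).symm
      _ ≤ wkbEnergy y y' s * Real.exp s⁻¹ := by
        gcongr
        exact Real.one_le_exp hi
      _ ≤ _ := h2
      _ = _ := mul_comm _ _

theorem airy_neg_bounded {y y' : ℝ → ℝ} (hy : ∀ s, HasDerivAt y (y' s) s)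
    (hy' : ∀ s, HasDerivAt y' (-(s * y s)) s) :
    ∃ C > 0, ∀ s, 0 ≤ s → |y s| ≤ C ∧ |y' s| ≤ C * √(1 + s) := by
  have hc : Continuous y := continuous_iff_continuousAt.2 fun s => (hy s).continuousAt
  have hc' : Continuous y' := continuous_iff_continuousAt.2 fun s => (hy' s).continuousAt
  obtain ⟨a, ha⟩ := (isCompact_Icc (a := (0:ℝ)) (b := 1)).exists_bound_of_continuousOn
    hc.continuousOn
  obtain ⟨b, hb⟩ := (isCompact_Icc (a := (0:ℝ)) (b := 1)).exists_bound_of_continuousOn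
    hc'.continuousOn
  set K := Real.exp 1 * wkbEnergy y y' 1 with hK
  refine ⟨1 + |a| + |b| + 2 * |K|, by positivity, fun s hs => ?_⟩
  have hs1 : 1 ≤ √(1 + s) := Real.one_le_sqrt.2 (by linarith)
  rcases le_total s 1 with h | h
  · have h1 := ha s ⟨hs, h⟩
    have h2 := hb s ⟨hs, h⟩
    rw [Real.norm_eq_abs] at h1 h2
    have := le_abs_self a
    have := le_abs_self b
    have := abs_nonneg a
    have := abs_nonneg b
    have := abs_nonneg K
    refine ⟨by linarith, ?_⟩
    calc |y' s| ≤ (1 + |a| + |b| + 2 * |K|) * 1 := by linarith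
      _ ≤ _ := by gcongr
  · have hE := (wkbEnergy_comparable hy hy' h).2
    obtain ⟨-, hl, -⟩ := abs_wkbEnergy_bounds (y := y) (y' := y') h
    have hr : 1 ≤ √s := Real.one_le_sqrt.2 h
    have hsq : √s ^ 2 = s := Real.sq_sqrt hs
    have hp1 : 0 ≤ y' s ^ 2 / √s := by positivity
    have hp2 : 0 ≤ √s * y s ^ 2 := by positivity
    have hKle : wkbEnergy y y' s ≤ |K| := hE.trans (le_abs_self _)
    have hF : y' s ^ 2 / √s + √s * y s ^ 2 ≤ 2 * |K| := by
      have := abs_nonneg K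
      linarith
    have hK1 : 2 * |K| ≤ (1 + 2 * |K|) ^ 2 := by nlinarith [abs_nonneg K]
    have hle : 1 + 2 * |K| ≤ 1 + |a| + |b| + 2 * |K| := by
      have := abs_nonneg a
      have := abs_nonneg b
      linarith
    constructor
    · refine (abs_le_of_sq_le_sq ?_ (by positivity)).trans hle
      nlinarith [sq_nonneg (y s)]
    · have h3 : |y' s| ≤ (1 + 2 * |K|) * √s := by
        rw [← abs_of_nonneg (by positivity : 0 ≤ (1 + 2 * |K|) * √s)]
        rw [← sq_le_sq]
        have h4 : y' s ^ 2 ≤ 2 * |K| * √s := by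
          rw [← div_le_iff₀ (by positivity)]
          linarith
        calc y' s ^ 2 ≤ 2 * |K| * √s := h4
          _ ≤ (1 + 2 * |K|) ^ 2 * √s ^ 2 := by
            gcongr
            nlinarith
          _ = _ := by ring
      refine h3.trans ?_
      gcongr
      linarith

theorem airy_neg_deriv_sq_ge {y y' : ℝ → ℝ} (hy : ∀ s, HasDerivAt y (y' s) s)
    (hy' : ∀ s, HasDerivAt y' (-(s * y s)) s) (hne : ∃ s, 1 ≤ s ∧ y s ≠ 0) :
    ∃ c > 0, ∀ s, 1 ≤ s → y s = 0 → c * √s ≤ y' s ^ 2 := by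
  have hpos : 0 < wkbEnergy y y' 1 := by
    obtain ⟨s, hs, hys⟩ := hne
    have h1 := (wkbEnergy_comparable hy hy' hs).2
    obtain ⟨-, hl, -⟩ := abs_wkbEnergy_bounds (y := y) (y' := y') hs
    have hr : 1 ≤ √s := Real.one_le_sqrt.2 hs
    have hp1 : 0 ≤ y' s ^ 2 / √s := by positivity
    have hp2 : 0 < √s * y s ^ 2 := by positivity
    exact pos_of_mul_pos_right (by linarith : 0 < Real.exp 1 * _) (Real.exp_pos 1).le
  refine ⟨Real.exp (-1) * wkbEnergy y y' 1, by positivity, fun s hs h0 => ?_⟩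
  have h1 := (wkbEnergy_comparable hy hy' hs).1
  have hr : 1 ≤ √s := Real.one_le_sqrt.2 hs
  rw [← le_div_iff₀ (by positivity)]
  refine h1.trans (le_of_eq ?_)
  simp [wkbEnergy, h0]

theorem airy_neg_integral_sq {y y' : ℝ → ℝ} (hy : ∀ s, HasDerivAt y (y' s) s)
    (hy' : ∀ s, HasDerivAt y' (-(s * y s)) s) {s : ℝ} (h0 : y s = 0) :
    ∫ x in (0:ℝ)..s, y x ^ 2 = y' s ^ 2 - y' 0 ^ 2 := by
  have hc : Continuous y := continuous_iff_continuousAt.2 fun s => (hy s).continuousAt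
  have hd : ∀ x, HasDerivAt (fun x => x * y x ^ 2 + y' x ^ 2) (y x ^ 2) x := fun x => by
    refine (((hasDerivAt_id x).mul ((hy x).pow 2)).add ((hy' x).pow 2)).congr_deriv ?_
    simp
    ring
  rw [intervalIntegral.integral_eq_sub_of_hasDerivAt (fun x _ => hd x)
    ((hc.pow 2).intervalIntegrable _ _)]
  simp [h0]

theorem airy_mul_deriv_nonpos {A A' : ℝ → ℝ} (hA : ∀ x, HasDerivAt A (A' x) x)
    (hA' : ∀ x, HasDerivAt A' (x * A x) x)
    (hint : IntegrableOn (fun x => A x ^ 2) (Set.Ioi 0)) {x : ℝ} (hx : 0 ≤ x) :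
    A x * A' x ≤ 0 := by
  by_contra! hpos
  have hd : ∀ z, HasDerivAt (fun z => A z * A' z) (A' z ^ 2 + z * A z ^ 2) z := fun z => by
    refine ((hA z).mul (hA' z)).congr_deriv ?_
    ring
  have hd2 : ∀ z, HasDerivAt (fun z => A z ^ 2) (2 * (A z * A' z)) z := fun z => by
    refine ((hA z).pow 2).congr_deriv ?_
    simp
    ring
  have hm1 : MonotoneOn (fun z => A z * A' z) (Set.Ici x) := by
    refine monotoneOn_of_hasDerivWithinAt_nonneg (convex_Ici x)
      (fun z _ => (hd z).continuousAt.continuousWithinAt)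
      (fun z _ => (hd z).hasDerivWithinAt) fun z hz => ?_
    have : 0 ≤ z := hx.trans (interior_subset hz)
    positivity
  have hm2 : MonotoneOn (fun z => A z ^ 2) (Set.Ici x) := by
    refine monotoneOn_of_hasDerivWithinAt_nonneg (convex_Ici x)
      (fun z _ => (hd2 z).continuousAt.continuousWithinAt)
      (fun z _ => (hd2 z).hasDerivWithinAt) fun z hz => ?_
    have h1 := hm1 Set.self_mem_Ici (interior_subset hz) (interior_subset hz)
    have h2 : 0 < A z * A' z := hpos.trans_le h1
    positivity
  have hAx : 0 < A x ^ 2 := by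
    have : A x ≠ 0 := fun h => by simp [h] at hpos
    positivity
  have hconst : IntegrableOn (fun _ : ℝ => A x ^ 2) (Set.Ioi x) := by
    refine Integrable.mono' (hint.mono_set (Set.Ioi_subset_Ioi hx))
      aestronglyMeasurable_const ?_
    refine (ae_restrict_iff' measurableSet_Ioi).2 (Eventually.of_forall fun z hz => ?_)
    rw [Real.norm_of_nonneg hAx.le]
    exact hm2 Set.self_mem_Ici (Set.mem_Ici.2 (Set.mem_Ioi.1 hz).le) (Set.mem_Ioi.1 hz).le
  rw [integrableOn_const_iff] at hconst
  rcases hconst with h | h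
  · exact hAx.ne' (by simpa using h)
  · simp at h

theorem airy_pos_variation {A A' : ℝ → ℝ} (hA : ∀ x, HasDerivAt A (A' x) x)
    (hA' : ∀ x, HasDerivAt A' (x * A x) x) (hne : ∀ x, 0 ≤ x → A x ≠ 0)
    (hint : IntegrableOn (fun x => A x ^ 2) (Set.Ioi 0)) {x : ℝ} (hx : 0 ≤ x) :
    |A x| ≤ |A 0| ∧ ∫ z in (0:ℝ)..x, |A' z| ≤ |A 0| := by
  have key : ∀ {A A' : ℝ → ℝ}, (∀ x, HasDerivAt A (A' x) x) →
      (∀ x, HasDerivAt A' (x * A x) x) → (∀ x, 0 ≤ x → A x ≠ 0) →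
      IntegrableOn (fun x => A x ^ 2) (Set.Ioi 0) → 0 < A 0 →
      |A x| ≤ |A 0| ∧ ∫ z in (0:ℝ)..x, |A' z| ≤ |A 0| := by
    intro A A' hA hA' hne hint h0
    have hc : Continuous A := continuous_iff_continuousAt.2 fun s => (hA s).continuousAt
    have hc' : Continuous A' := continuous_iff_continuousAt.2 fun s => (hA' s).continuousAt
    have hp : ∀ z, 0 ≤ z → 0 < A z := by
      intro z hz
      by_contra! hneg
      obtain ⟨w, hw, hw0⟩ := intermediate_value_Icc' hz hc.continuousOn ⟨hneg, h0.le⟩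
      exact hne w hw.1 hw0
    have hn : ∀ z, 0 ≤ z → A' z ≤ 0 := fun z hz =>
      nonpos_of_mul_nonpos_right (airy_mul_deriv_nonpos hA hA' hint hz) (hp z hz)
    have hI : ∫ z in (0:ℝ)..x, |A' z| = A 0 - A x := by
      rw [intervalIntegral.integral_congr (g := fun z => -A' z), intervalIntegral.integral_neg,
        intervalIntegral.integral_eq_sub_of_hasDerivAt (fun z _ => hA z)
          (hc'.intervalIntegrable _ _)]
      · ring
      · intro z hz
        rw [Set.uIcc_of_le hx] at hz
        exact abs_of_nonpos (hn z hz.1)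
    have hI0 : 0 ≤ ∫ z in (0:ℝ)..x, |A' z| :=
      intervalIntegral.integral_nonneg hx fun z _ => abs_nonneg _
    have := hp x hx
    rw [abs_of_pos this, abs_of_pos h0]
    constructor <;> linarith
  rcases lt_or_gt_of_ne (hne 0 le_rfl) with h0 | h0
  · have := key (A := fun x => -A x) (A' := fun x => -A' x) (fun x => (hA x).neg)
      (fun x => (hA' x).neg.congr_deriv (by ring)) (fun x hx => neg_ne_zero.2 (hne x hx))
      (by simpa using hint) (by simpa using h0)
    simpa using this
  · exact key hA hA' hne hint h0

/-- Uniform bounds for the decaying Airy function: it is bounded, its variation over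
`[-w, ∞)` is `O(w^{3/2})`, and its squared norm over `[-w, ∞)` is at least `c w^{1/2}` when
`-w` is a zero. -/
theorem airy_uniform_bounds {A A' : ℝ → ℝ} (hA : ∀ x, HasDerivAt A (A' x) x)
    (hA' : ∀ x, HasDerivAt A' (x * A x) x) (hne : ∀ x, 0 ≤ x → A x ≠ 0)
    (hne' : ∃ s, 1 ≤ s ∧ A (-s) ≠ 0)
    (hint : IntegrableOn (fun x => A x ^ 2) (Set.Ioi 0)) {w₀ : ℝ} (hw₀ : 0 < w₀) :
    ∃ C > 0, (∀ x, |A x| ≤ C) ∧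
      (∀ w, w₀ ≤ w → ∀ s₁ s₂, -w ≤ s₁ → s₁ ≤ s₂ → ∫ z in s₁..s₂, |A' z| ≤ C * (w * √w)) ∧
      (∀ w, w₀ ≤ w → A (-w) = 0 → √w ≤ C * ∫ x in Set.Ioi (-w), A x ^ 2) := by
  have hc : Continuous A := continuous_iff_continuousAt.2 fun s => (hA s).continuousAt
  have hc' : Continuous A' := continuous_iff_continuousAt.2 fun s => (hA' s).continuousAt
  have hy : ∀ s, HasDerivAt (fun s => A (-s)) ((fun s => -A' (-s)) s) s := fun s => by
    exact ((hA (-s)).comp s (hasDerivAt_neg s)).congr_deriv (by simp)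
  have hy' : ∀ s, HasDerivAt (fun s => -A' (-s)) (-(s * A (-s))) s := fun s => by
    exact ((hA' (-s)).comp s (hasDerivAt_neg s)).neg.congr_deriv (by simp)
  obtain ⟨C₁, hC₁, hb⟩ := airy_neg_bounded hy hy'
  obtain ⟨c, hc0, hlow⟩ := airy_neg_deriv_sq_ge hy hy' hne'
  have hn0 : 0 < ∫ x in Set.Ioi (0:ℝ), A x ^ 2 := by
    rw [setIntegral_pos_iff_support_of_nonneg_ae
      (Eventually.of_forall fun x => sq_nonneg _) hint]
    have : Set.Ioi (0:ℝ) ⊆ (Function.support fun x => A x ^ 2) ∩ Set.Ioi 0 := fun x hx =>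
      ⟨by simpa using hne x (Set.mem_Ioi.1 hx).le, hx⟩
    exact lt_of_lt_of_le (by simp) (measure_mono this)
  set n₀ := ∫ x in Set.Ioi (0:ℝ), A x ^ 2 with hn₀
  set C₂ := C₁ * √(w₀⁻¹ + 1) + |A 0| / (w₀ * √w₀) with hC₂
  set C₃ := c⁻¹ * (1 + A' 0 ^ 2 / n₀) + n₀⁻¹ with hC₃
  have hA0 := abs_nonneg (A 0)
  have hC₂0 : 0 ≤ C₂ := by positivity
  have hC₃0 : 0 ≤ C₃ := by positivity
  refine ⟨C₁ + |A 0| + C₂ + C₃, by positivity, fun x => ?_, ?_, ?_⟩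
  · rcases le_total 0 x with h | h
    · have := (airy_pos_variation hA hA' hne hint h).1
      linarith
    · have := (hb (-x) (by linarith)).1
      simp only [neg_neg] at this
      linarith
  · intro w hw s₁ s₂ hs₁ hs
    have hw0 : 0 < w := hw₀.trans_le hw
    have hi : ∀ a b : ℝ, IntervalIntegrable (fun z => |A' z|) volume a b := fun a b =>
      hc'.abs.intervalIntegrable _ _
    have hmono : ∫ z in s₁..s₂, |A' z| ≤ ∫ z in (-w)..(max s₂ 0), |A' z| :=
      intervalIntegral.integral_mono_interval hs₁ hs (le_max_left _ _)
        (Eventually.of_forall fun z => abs_nonneg _) (hi _ _)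
    have hneg : ∫ z in (-w)..0, |A' z| ≤ C₁ * √(1 + w) * w := by
      have h1 := intervalIntegral.norm_integral_le_of_norm_le_const (a := -w) (b := 0)
        (f := fun z => |A' z|) (C := C₁ * √(1 + w)) (by
          intro z hz
          rw [Set.uIoc_of_le (by linarith)] at hz
          have := (hb (-z) (by linarith [hz.2])).2
          simp only [neg_neg, abs_neg] at this
          rw [norm_eq_abs, abs_abs]
          refine this.trans ?_
          gcongr
          linarith [hz.1])
      have h2 := (le_abs_self _).trans h1
      simpa [abs_of_pos hw0] using h2
    have hpos := (airy_pos_variation hA hA' hne hint (le_max_right s₂ 0)).2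
    have hsq : √(1 + w) ≤ √(w₀⁻¹ + 1) * √w := by
      rw [← Real.sqrt_mul (by positivity)]
      apply Real.sqrt_le_sqrt
      have : 1 ≤ w₀⁻¹ * w := by
        rw [inv_mul_eq_div, le_div_iff₀ hw₀]
        linarith
      linarith
    have hA1 : |A 0| ≤ |A 0| / (w₀ * √w₀) * (w * √w) := by
      rw [div_mul_eq_mul_div, le_div_iff₀ (by positivity)]
      gcongr
    calc ∫ z in s₁..s₂, |A' z| ≤ ∫ z in (-w)..(max s₂ 0), |A' z| := hmono
      _ = (∫ z in (-w)..0, |A' z|) + ∫ z in (0:ℝ)..(max s₂ 0), |A' z| :=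
        (intervalIntegral.integral_add_adjacent_intervals (hi _ _) (hi _ _)).symm
      _ ≤ C₁ * (√(w₀⁻¹ + 1) * √w) * w + |A 0| / (w₀ * √w₀) * (w * √w) := by
        refine add_le_add (hneg.trans ?_) (hpos.trans hA1)
        gcongr
      _ = C₂ * (w * √w) := by rw [hC₂]; ring
      _ ≤ _ := by
        gcongr
        linarith
  · intro w hw hz
    have hw0 : 0 < w := hw₀.trans_le hw
    have hi1 : IntegrableOn (fun x => A x ^ 2) (Set.Ioc (-w) 0) :=
      ((hc.pow 2).integrableOn_Icc).mono_set Set.Ioc_subset_Icc_self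
    have hsplit : ∫ x in Set.Ioi (-w), A x ^ 2 = (∫ x in (-w)..0, A x ^ 2) + n₀ := by
      rw [intervalIntegral.integral_of_le (by linarith), ← setIntegral_union
        (Set.Ioc_disjoint_Ioi le_rfl) measurableSet_Ioi hi1 hint,
        Set.Ioc_union_Ioi_eq_Ioi (by linarith)]
    have hq : ∫ x in (-w)..0, A x ^ 2 = A' (-w) ^ 2 - A' 0 ^ 2 := by
      have := airy_neg_integral_sq hy hy' hz
      rw [intervalIntegral.integral_comp_neg (f := fun x => A x ^ 2)] at this
      simpa using this
    have hq0 : 0 ≤ ∫ x in (-w)..0, A x ^ 2 :=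
      intervalIntegral.integral_nonneg (by linarith) fun z _ => sq_nonneg _
    rw [hsplit]
    set J := ∫ x in (-w)..0, A x ^ 2 with hJ
    have hmain : √w ≤ C₃ * (J + n₀) := by
      rcases le_total 1 w with h | h
      · have h1 := hlow w h hz
        simp only [neg_sq] at h1
        have h2 : √w ≤ c⁻¹ * A' (-w) ^ 2 := by
          rw [inv_mul_eq_div, le_div_iff₀ hc0]
          linarith
        have h3 : A' 0 ^ 2 ≤ A' 0 ^ 2 / n₀ * (J + n₀) := by
          rw [div_mul_eq_mul_div, le_div_iff₀ hn0]
          gcongr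
          linarith
        have h4 : A' (-w) ^ 2 ≤ (1 + A' 0 ^ 2 / n₀) * (J + n₀) := by
          rw [add_mul]
          linarith
        calc √w ≤ c⁻¹ * A' (-w) ^ 2 := h2
          _ ≤ c⁻¹ * ((1 + A' 0 ^ 2 / n₀) * (J + n₀)) := by gcongr
          _ = c⁻¹ * (1 + A' 0 ^ 2 / n₀) * (J + n₀) := by ring
          _ ≤ C₃ * (J + n₀) := by
            gcongr
            rw [hC₃]
            linarith [inv_pos.2 hn0]
      · have h1 : √w ≤ 1 := Real.sqrt_le_one.2 h
        calc √w ≤ 1 := h1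
          _ = n₀⁻¹ * n₀ := (inv_mul_cancel₀ hn0.ne').symm
          _ ≤ C₃ * (J + n₀) := by
            gcongr
            · rw [hC₃]
              have : 0 ≤ c⁻¹ * (1 + A' 0 ^ 2 / n₀) := by positivity
              linarith
            · linarith
    refine hmain.trans ?_
    gcongr
    linarith

theorem norm_exp_I_mul_real (x : ℝ) : ‖Complex.exp (Complex.I * (x : ℂ))‖ = 1 := by
  rw [mul_comm, Complex.norm_exp_ofReal_mul_I]

theorem norm_integral_exp_le_of_deriv_ge {φ φ' φ'' f f' : ℝ → ℝ} {a b μ M : ℝ} (hab : a ≤ b)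
    (hφ : ∀ x ∈ Set.Icc a b, HasDerivAt φ (φ' x) x)
    (hφ' : ∀ x ∈ Set.Icc a b, HasDerivAt φ' (φ'' x) x)
    (hφ'' : ContinuousOn φ'' (Set.Icc a b)) (hpos : ∀ x ∈ Set.Icc a b, 0 ≤ φ'' x)
    (hf : ∀ x ∈ Set.Icc a b, HasDerivAt f (f' x) x) (hf' : ContinuousOn f' (Set.Icc a b))
    (hμ : 0 < μ) (hge : ∀ x ∈ Set.Icc a b, μ ≤ |φ' x|) (hM : ∀ x ∈ Set.Icc a b, |f x| ≤ M) :
    ‖∫ x in a..b, Complex.exp (Complex.I * (φ x : ℂ)) * (f x : ℂ)‖ ≤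
      (4 * M + ∫ x in a..b, |f' x|) / μ := by
  have hu : Set.uIcc a b = Set.Icc a b := Set.uIcc_of_le hab
  have ha : a ∈ Set.Icc a b := Set.left_mem_Icc.2 hab
  have hb : b ∈ Set.Icc a b := Set.right_mem_Icc.2 hab
  have hM0 : 0 ≤ M := (abs_nonneg _).trans (hM a ha)
  have hne : ∀ x ∈ Set.Icc a b, φ' x ≠ 0 := fun x hx h => by
    have := hge x hx
    rw [h, abs_zero] at this
    linarith
  have cφ : ContinuousOn φ (Set.Icc a b) := fun x hx => (hφ x hx).continuousAt.continuousWithinAt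
  have cφ' : ContinuousOn φ' (Set.Icc a b) :=
    fun x hx => (hφ' x hx).continuousAt.continuousWithinAt
  have cf : ContinuousOn f (Set.Icc a b) := fun x hx => (hf x hx).continuousAt.continuousWithinAt
  have ce : ContinuousOn (fun x => Complex.exp (Complex.I * (φ x : ℂ))) (Set.Icc a b) :=
    (continuousOn_const.mul (Complex.continuous_ofReal.comp_continuousOn cφ)).cexp
  set g : ℝ → ℝ := fun x => f x / φ' x with hg
  set g' : ℝ → ℝ := fun x => f' x / φ' x - f x * (φ'' x / φ' x ^ 2) with hg'
  have dg : ∀ x ∈ Set.Icc a b, HasDerivAt g (g' x) x := fun x hx => by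
    refine ((hf x hx).div (hφ' x hx) (hne x hx)).congr_deriv ?_
    have := hne x hx
    simp only [hg']
    field_simp
  have cq : ContinuousOn (fun x => φ'' x / φ' x ^ 2) (Set.Icc a b) :=
    hφ''.div (cφ'.pow 2) fun x hx => pow_ne_zero 2 (hne x hx)
  have cg' : ContinuousOn g' (Set.Icc a b) := (hf'.div cφ' hne).sub (cf.mul cq)
  have cg'c : ContinuousOn (fun x => (g' x : ℂ)) (Set.Icc a b) :=
    Complex.continuous_ofReal.comp_continuousOn cg'
  have cfc : ContinuousOn (fun x => (f x : ℂ)) (Set.Icc a b) :=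
    Complex.continuous_ofReal.comp_continuousOn cf
  have dF : ∀ x ∈ Set.uIcc a b,
      HasDerivAt (fun x => -Complex.I * (Complex.exp (Complex.I * (φ x : ℂ)) * (g x : ℂ)))
        (Complex.exp (Complex.I * (φ x : ℂ)) * (f x : ℂ) +
          -Complex.I * (Complex.exp (Complex.I * (φ x : ℂ)) * (g' x : ℂ))) x := by
    intro x hx
    rw [hu] at hx
    have h1 := (((hφ x hx).ofReal_comp.const_mul Complex.I).cexp.mul
      (dg x hx).ofReal_comp).const_mul (-Complex.I)
    refine h1.congr_deriv ?_
    have h2 : (φ' x : ℂ) ≠ 0 := by exact_mod_cast hne x hx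
    simp only [hg, Complex.ofReal_div]
    field_simp
    ring_nf
    simp only [Complex.I_sq]
    ring
  have i1 : IntervalIntegrable (fun x => Complex.exp (Complex.I * (φ x : ℂ)) * (f x : ℂ))
      volume a b := ContinuousOn.intervalIntegrable (by rw [hu]; exact ce.mul cfc)
  have i2 : IntervalIntegrable
      (fun x => -Complex.I * (Complex.exp (Complex.I * (φ x : ℂ)) * (g' x : ℂ)))
      volume a b :=
    ContinuousOn.intervalIntegrable (by rw [hu]; exact continuousOn_const.mul (ce.mul cg'c))
  have hFTC := intervalIntegral.integral_eq_sub_of_hasDerivAt dF (i1.add i2)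
  rw [intervalIntegral.integral_add i1 i2] at hFTC
  have hinv : ∀ x ∈ Set.Icc a b, |(φ' x)⁻¹| ≤ μ⁻¹ := fun x hx => by
    rw [abs_inv]
    exact inv_anti₀ hμ (hge x hx)
  have hgb : ∀ x ∈ Set.Icc a b, |g x| ≤ M * μ⁻¹ := fun x hx => by
    rw [hg]
    simp only [div_eq_mul_inv, abs_mul]
    exact mul_le_mul (hM x hx) (hinv x hx) (abs_nonneg _) hM0
  have hFb : ∀ x ∈ Set.Icc a b,
      ‖-Complex.I * (Complex.exp (Complex.I * (φ x : ℂ)) * (g x : ℂ))‖ ≤ M * μ⁻¹ := fun x hx => by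
    rw [norm_mul, norm_mul, norm_exp_I_mul_real, norm_neg, Complex.norm_I, Complex.norm_real]
    simpa using hgb x hx
  have hq : ∫ x in a..b, φ'' x / φ' x ^ 2 = (φ' a)⁻¹ - (φ' b)⁻¹ := by
    have := intervalIntegral.integral_eq_sub_of_hasDerivAt (f := fun x => -(φ' x)⁻¹)
      (f' := fun x => φ'' x / φ' x ^ 2) (a := a) (b := b) (fun x hx => by
        rw [hu] at hx
        refine ((hφ' x hx).inv (hne x hx)).neg.congr_deriv ?_
        ring) (ContinuousOn.intervalIntegrable (by rw [hu]; exact cq))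
    rw [this]
    ring
  have iq : IntervalIntegrable (fun x => φ'' x / φ' x ^ 2) volume a b :=
    ContinuousOn.intervalIntegrable (by rw [hu]; exact cq)
  have ifa : IntervalIntegrable (fun x => |f' x|) volume a b :=
    ContinuousOn.intervalIntegrable (by rw [hu]; exact hf'.abs)
  have hrem : ‖∫ x in a..b, -Complex.I * (Complex.exp (Complex.I * (φ x : ℂ)) * (g' x : ℂ))‖ ≤
      ∫ x in a..b, (μ⁻¹ * |f' x| + M * (φ'' x / φ' x ^ 2)) := by
    refine intervalIntegral.norm_integral_le_of_norm_le hab (Eventually.of_forall fun x hx => ?_)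
      ((ifa.const_mul _).add (iq.const_mul _))
    have hx' := Set.Ioc_subset_Icc_self hx
    rw [norm_mul, norm_mul, norm_exp_I_mul_real, norm_neg, Complex.norm_I, Complex.norm_real,
      one_mul, one_mul, Real.norm_eq_abs]
    have hq0 : 0 ≤ φ'' x / φ' x ^ 2 := div_nonneg (hpos x hx') (sq_nonneg _)
    refine (abs_sub _ _).trans (add_le_add ?_ ?_)
    · rw [div_eq_mul_inv, abs_mul, mul_comm]
      gcongr
      exact hinv x hx'
    · rw [abs_mul, abs_of_nonneg hq0]
      gcongr
      exact hM x hx'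
  have hbd : ∫ x in a..b, (μ⁻¹ * |f' x| + M * (φ'' x / φ' x ^ 2)) =
      μ⁻¹ * (∫ x in a..b, |f' x|) + M * ((φ' a)⁻¹ - (φ' b)⁻¹) := by
    rw [intervalIntegral.integral_add (ifa.const_mul _) (iq.const_mul _),
      intervalIntegral.integral_const_mul, intervalIntegral.integral_const_mul, hq]
  rw [hbd] at hrem
  have e : ∫ x in a..b, Complex.exp (Complex.I * (φ x : ℂ)) * (f x : ℂ) =
      -Complex.I * (Complex.exp (Complex.I * (φ b : ℂ)) * (g b : ℂ)) -
      -Complex.I * (Complex.exp (Complex.I * (φ a : ℂ)) * (g a : ℂ)) -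
      ∫ x in a..b, -Complex.I * (Complex.exp (Complex.I * (φ x : ℂ)) * (g' x : ℂ)) := by
    rw [← hFTC]
    ring
  rw [e]
  have h1 := (abs_le.1 (hinv a ha)).2
  have h2 := (abs_le.1 (hinv b hb)).1
  have h3 : M * ((φ' a)⁻¹ - (φ' b)⁻¹) ≤ M * (2 * μ⁻¹) := by
    gcongr
    linarith
  refine (norm_sub_le _ _).trans ((add_le_add ((norm_sub_le _ _).trans
    (add_le_add (hFb b hb) (hFb a ha))) hrem).trans ?_)
  rw [div_eq_mul_inv]
  linarith

theorem norm_integral_exp_le_of_deriv2_ge {φ φ' φ'' f f' : ℝ → ℝ} {a b Λ M δ : ℝ} (hab : a ≤ b)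
    (hφ : ∀ x ∈ Set.Icc a b, HasDerivAt φ (φ' x) x)
    (hφ' : ∀ x ∈ Set.Icc a b, HasDerivAt φ' (φ'' x) x)
    (hφ'' : ContinuousOn φ'' (Set.Icc a b)) (hΛ : 0 < Λ) (hge : ∀ x ∈ Set.Icc a b, Λ ≤ φ'' x)
    (hf : ∀ x ∈ Set.Icc a b, HasDerivAt f (f' x) x) (hf' : ContinuousOn f' (Set.Icc a b))
    (hM : ∀ x ∈ Set.Icc a b, |f x| ≤ M) (hδ : 0 < δ) :
    ‖∫ x in a..b, Complex.exp (Complex.I * (φ x : ℂ)) * (f x : ℂ)‖ ≤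
      2 * δ * M + 2 * ((4 * M + ∫ x in a..b, |f' x|) / (Λ * δ)) := by
  have hu : Set.uIcc a b = Set.Icc a b := Set.uIcc_of_le hab
  have hM0 : 0 ≤ M := (abs_nonneg _).trans (hM a (Set.left_mem_Icc.2 hab))
  have cφ' : ContinuousOn φ' (Set.Icc a b) :=
    fun x hx => (hφ' x hx).continuousAt.continuousWithinAt
  have hmvt : ∀ x ∈ Set.Icc a b, ∀ y ∈ Set.Icc a b, x ≤ y → Λ * (y - x) ≤ φ' y - φ' x := by
    intro x hx y hy hxy
    refine (convex_Icc a b).mul_sub_le_image_sub_of_le_deriv cφ' (fun z hz =>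
      (hφ' z (interior_subset hz)).differentiableAt.differentiableWithinAt) (fun z hz => ?_)
      x hx y hy hxy
    rw [(hφ' z (interior_subset hz)).deriv]
    exact hge z (interior_subset hz)
  obtain ⟨c, hc, hcl, hcr⟩ : ∃ c ∈ Set.Icc a b, (∀ x ∈ Set.Icc a b, x < c → φ' c ≤ 0) ∧
      (∀ x ∈ Set.Icc a b, c < x → 0 ≤ φ' c) := by
    rcases le_total 0 (φ' a) with h | h
    · exact ⟨a, Set.left_mem_Icc.2 hab, fun x hx hxa => absurd hx.1 (not_le.2 hxa), fun _ _ _ => h⟩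
    · rcases le_total (φ' b) 0 with h' | h'
      · exact ⟨b, Set.right_mem_Icc.2 hab, fun _ _ _ => h',
          fun x hx hxb => absurd hx.2 (not_le.2 hxb)⟩
      · obtain ⟨c, hc, hc0⟩ := intermediate_value_Icc hab cφ' ⟨h, h'⟩
        exact ⟨c, hc, fun _ _ _ => hc0.le, fun _ _ _ => hc0.ge⟩
  have cφ : ContinuousOn φ (Set.Icc a b) := fun x hx => (hφ x hx).continuousAt.continuousWithinAt
  have cf : ContinuousOn f (Set.Icc a b) := fun x hx => (hf x hx).continuousAt.continuousWithinAt
  have cF : ContinuousOn (fun x => Complex.exp (Complex.I * (φ x : ℂ)) * (f x : ℂ))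
      (Set.Icc a b) :=
    (continuousOn_const.mul (Complex.continuous_ofReal.comp_continuousOn cφ)).cexp.mul
      (Complex.continuous_ofReal.comp_continuousOn cf)
  have hsub : ∀ u v, u ∈ Set.Icc a b → v ∈ Set.Icc a b → Set.Icc u v ⊆ Set.Icc a b :=
    fun u v hu hv => Set.Icc_subset_Icc hu.1 hv.2
  have hint : ∀ u v, u ∈ Set.Icc a b → v ∈ Set.Icc a b → u ≤ v →
      IntervalIntegrable (fun x => Complex.exp (Complex.I * (φ x : ℂ)) * (f x : ℂ))
        volume u v := fun u v hu hv huv =>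
    ContinuousOn.intervalIntegrable (by rw [Set.uIcc_of_le huv]; exact cF.mono (hsub u v hu hv))
  have houter : ∀ u v, u ∈ Set.Icc a b → v ∈ Set.Icc a b → u ≤ v →
      (∀ x ∈ Set.Icc u v, u < v → Λ * δ ≤ |φ' x|) →
      ‖∫ x in u..v, Complex.exp (Complex.I * (φ x : ℂ)) * (f x : ℂ)‖ ≤
        (4 * M + ∫ x in a..b, |f' x|) / (Λ * δ) := by
    intro u v hu' hv' huv hbig
    have hI0 : 0 ≤ ∫ x in a..b, |f' x| :=
      intervalIntegral.integral_nonneg hab fun _ _ => abs_nonneg _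
    rcases huv.eq_or_lt with rfl | huv'
    · rw [intervalIntegral.integral_same, norm_zero]
      positivity
    · have hs := hsub u v hu' hv'
      refine (norm_integral_exp_le_of_deriv_ge (μ := Λ * δ) huv (fun x hx => hφ x (hs hx))
        (fun x hx => hφ' x (hs hx)) (hφ''.mono hs) (fun x hx => hΛ.le.trans (hge x (hs hx)))
        (fun x hx => hf x (hs hx)) (hf'.mono hs) (by positivity)
        (fun x hx => hbig x hx huv') (fun x hx => hM x (hs hx))).trans ?_
      gcongr
      refine intervalIntegral.integral_mono_interval hu'.1 huv hv'.2
        (Eventually.of_forall fun _ => abs_nonneg _)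
        (ContinuousOn.intervalIntegrable (by rw [hu]; exact hf'.abs))
  set u := max a (c - δ) with hudef
  set v := min b (c + δ) with hvdef
  have huc : u ≤ c := max_le hc.1 (by linarith)
  have hcv : c ≤ v := le_min hc.2 (by linarith)
  have huI : u ∈ Set.Icc a b := ⟨le_max_left _ _, huc.trans hc.2⟩
  have hvI : v ∈ Set.Icc a b := ⟨hc.1.trans hcv, min_le_left _ _⟩
  have haI := Set.left_mem_Icc.2 hab
  have hbI := Set.right_mem_Icc.2 hab
  have h1 := houter a u haI huI huI.1 (fun x hx hlt => by
    have hu2 : u = c - δ := by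
      rcases max_choice a (c - δ) with h | h
      · exact absurd hlt (by rw [hudef, h]; exact lt_irrefl _)
      · exact h
    have hxI := hsub a u haI huI hx
    have hxc : x < c := by linarith [hx.2]
    have h3 := hmvt x hxI c hc hxc.le
    have h4 := hcl x hxI hxc
    have h5 : Λ * δ ≤ Λ * (c - x) := by
      gcongr
      linarith [hx.2]
    rw [abs_of_nonpos (by nlinarith)]
    linarith)
  have h2 := houter v b hvI hbI hvI.2 (fun x hx hlt => by
    have hv2 : v = c + δ := by
      rcases min_choice b (c + δ) with h | h
      · exact absurd hlt (by rw [hvdef, h]; exact lt_irrefl _)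
      · exact h
    have hxI := hsub v b hvI hbI hx
    have hxc : c < x := by linarith [hx.1]
    have h3 := hmvt c hc x hxI hxc.le
    have h4 := hcr x hxI hxc
    have h5 : Λ * δ ≤ Λ * (x - c) := by
      gcongr
      linarith [hx.1]
    rw [abs_of_nonneg (by nlinarith)]
    linarith)
  have h3 : ‖∫ x in u..v, Complex.exp (Complex.I * (φ x : ℂ)) * (f x : ℂ)‖ ≤ 2 * δ * M := by
    refine (intervalIntegral.norm_integral_le_of_norm_le_const (C := M) fun x hx => ?_).trans ?_
    · rw [Set.uIoc_of_le (huc.trans hcv)] at hx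
      rw [norm_mul, norm_exp_I_mul_real, one_mul, Complex.norm_real]
      exact hM x (hsub u v huI hvI (Set.Ioc_subset_Icc_self hx))
    · rw [abs_of_nonneg (by linarith), mul_comm]
      gcongr
      have : v ≤ c + δ := min_le_right _ _
      have : c - δ ≤ u := le_max_right _ _
      linarith
  have i1 := hint a u haI huI huI.1
  have i2 := hint u v huI hvI (huc.trans hcv)
  have i3 := hint v b hvI hbI hvI.2
  rw [← intervalIntegral.integral_add_adjacent_intervals (i1.trans i2) i3,
    ← intervalIntegral.integral_add_adjacent_intervals i1 i2]
  refine (norm_add_le _ _).trans ((add_le_add ((norm_add_le _ _).trans (add_le_add h1 h3))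
    h2).trans (le_of_eq ?_))
  ring

theorem norm_integral_exp_le_of_abs_deriv2_ge {φ φ' φ'' f f' : ℝ → ℝ} {a b Λ M δ : ℝ}
    (hab : a ≤ b)
    (hφ : ∀ x ∈ Set.Icc a b, HasDerivAt φ (φ' x) x)
    (hφ' : ∀ x ∈ Set.Icc a b, HasDerivAt φ' (φ'' x) x)
    (hφ'' : ContinuousOn φ'' (Set.Icc a b)) (hΛ : 0 < Λ)
    (hge : (∀ x ∈ Set.Icc a b, Λ ≤ φ'' x) ∨ (∀ x ∈ Set.Icc a b, Λ ≤ -φ'' x))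
    (hf : ∀ x ∈ Set.Icc a b, HasDerivAt f (f' x) x) (hf' : ContinuousOn f' (Set.Icc a b))
    (hM : ∀ x ∈ Set.Icc a b, |f x| ≤ M) (hδ : 0 < δ) :
    ‖∫ x in a..b, Complex.exp (Complex.I * (φ x : ℂ)) * (f x : ℂ)‖ ≤
      2 * δ * M + 2 * ((4 * M + ∫ x in a..b, |f' x|) / (Λ * δ)) := by
  rcases hge with hge | hge
  · exact norm_integral_exp_le_of_deriv2_ge hab hφ hφ' hφ'' hΛ hge hf hf' hM hδ
  · have h := norm_integral_exp_le_of_deriv2_ge (φ := fun x => -φ x) (φ' := fun x => -φ' x)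
      (φ'' := fun x => -φ'' x) hab (fun x hx => (hφ x hx).neg) (fun x hx => (hφ' x hx).neg)
      hφ''.neg hΛ hge hf hf' hM hδ
    convert h using 1
    rw [← Complex.norm_conj, intervalIntegral.integral_of_le hab, intervalIntegral.integral_of_le hab,
      ← integral_conj]
    congr 2
    ext x
    simp [← Complex.exp_conj]

theorem hasDerivAt_cbrt {θ : ℝ} (hθ : 0 < θ) :
    HasDerivAt (fun θ : ℝ => θ ^ ((1:ℝ)/3)) (1 / (3 * (θ ^ ((1:ℝ)/3)) ^ 2)) θ := by
  refine (Real.hasDerivAt_rpow_const (Or.inl hθ.ne')).congr_deriv ?_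
  rw [← Real.rpow_natCast, ← Real.rpow_mul hθ.le,
    show (1:ℝ)/3 - 1 = -((1:ℝ)/3 * (2:ℕ)) by norm_num, Real.rpow_neg hθ.le]
  ring

/-- First derivative of the dispersion relation `θ ↦ √(θ² + w θ^{4/3})`. -/
noncomputable def dispersionD1 (w θ : ℝ) : ℝ :=
  (3 * (θ ^ ((1:ℝ)/3)) ^ 2 + 2 * w) /
    (3 * θ ^ ((1:ℝ)/3) * √((θ ^ ((1:ℝ)/3)) ^ 2 + w))

/-- Second derivative of the dispersion relation `θ ↦ √(θ² + w θ^{4/3})`. -/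
noncomputable def dispersionD2 (w θ : ℝ) : ℝ :=
  -(w * ((θ ^ ((1:ℝ)/3)) ^ 2 + 2 * w)) /
    (9 * (θ ^ ((1:ℝ)/3)) ^ 4 * √((θ ^ ((1:ℝ)/3)) ^ 2 + w) ^ 3)

theorem sqrt_dispersion_eq {w θ : ℝ} (hθ : 0 < θ) :
    √(θ ^ 2 + w * θ ^ ((4:ℝ)/3)) =
      (θ ^ ((1:ℝ)/3)) ^ 2 * √((θ ^ ((1:ℝ)/3)) ^ 2 + w) := by
  have hp : 0 < θ ^ ((1:ℝ)/3) := Real.rpow_pos_of_pos hθ _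
  have h3 : θ = (θ ^ ((1:ℝ)/3)) ^ 3 := by
    rw [← Real.rpow_natCast, ← Real.rpow_mul hθ.le]
    norm_num
  have h4 : θ ^ ((4:ℝ)/3) = (θ ^ ((1:ℝ)/3)) ^ 4 := by
    rw [← Real.rpow_natCast, ← Real.rpow_mul hθ.le]
    norm_num
  rw [h4]
  nth_rewrite 1 [h3]
  generalize θ ^ ((1:ℝ)/3) = p at *
  rw [show (p ^ 3) ^ 2 + w * p ^ 4 = (p ^ 2) ^ 2 * (p ^ 2 + w) by ring,
    Real.sqrt_mul (by positivity), Real.sqrt_sq (by positivity)]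

theorem hasDerivAt_dispersion {w θ : ℝ} (hw : 0 < w) (hθ : 0 < θ) :
    HasDerivAt (fun θ : ℝ => √(θ ^ 2 + w * θ ^ ((4:ℝ)/3))) (dispersionD1 w θ) θ := by
  have hp : 0 < θ ^ ((1:ℝ)/3) := Real.rpow_pos_of_pos hθ _
  have hr2 : 0 < (θ ^ ((1:ℝ)/3)) ^ 2 + w := by positivity
  have h1 := hasDerivAt_cbrt hθ
  have h2 := (h1.pow 2).mul (((h1.pow 2).add_const w).sqrt hr2.ne')
  refine (h2.congr_of_eventuallyEq ?_).congr_deriv ?_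
  · filter_upwards [lt_mem_nhds hθ] with z hz
    exact sqrt_dispersion_eq hz
  · have hr := Real.sqrt_pos.2 hr2
    have hsq := Real.sq_sqrt hr2.le
    simp only [dispersionD1, Pi.pow_apply]
    generalize θ ^ ((1:ℝ)/3) = p at *
    generalize √(p ^ 2 + w) = r at *
    field_simp
    simp
    field_simp
    rw [hsq]
    ring

theorem hasDerivAt_dispersionD1 {w θ : ℝ} (hw : 0 < w) (hθ : 0 < θ) :
    HasDerivAt (dispersionD1 w) (dispersionD2 w θ) θ := by
  have hp : 0 < θ ^ ((1:ℝ)/3) := Real.rpow_pos_of_pos hθ _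
  have hr2 : 0 < (θ ^ ((1:ℝ)/3)) ^ 2 + w := by positivity
  have hr := Real.sqrt_pos.2 hr2
  have h1 := hasDerivAt_cbrt hθ
  have h2 := (((h1.pow 2).const_mul 3).add_const (2 * w)).div
    ((h1.const_mul 3).mul (((h1.pow 2).add_const w).sqrt hr2.ne'))
    (mul_pos (mul_pos three_pos hp) hr).ne'
  refine h2.congr_deriv ?_
  have hsq := Real.sq_sqrt hr2.le
  simp only [dispersionD2, Pi.pow_apply, Pi.mul_apply]
  generalize θ ^ ((1:ℝ)/3) = p at *
  generalize √(p ^ 2 + w) = r at *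
  have hw' : w = r ^ 2 - p ^ 2 := by linarith
  subst hw'
  field_simp
  simp
  ring

theorem dispersionD2_le {w₀ : ℝ} (hw₀ : 0 < w₀) :
    ∃ c > 0, ∀ w, w₀ ≤ w → ∀ h ∈ Set.Ioc (0:ℝ) 1, ∀ η ∈ Set.Icc (1/2 : ℝ) (3/2),
      c * √w / h ^ ((1:ℝ)/3) ≤ -(dispersionD2 w (η / h) / h ^ 2) := by
  set K := √(4 / w₀ + 1) with hK
  have hKpos : 0 < K := Real.sqrt_pos.2 (by positivity)
  refine ⟨1 / (144 * K), by positivity, fun w hw h hh η hη => ?_⟩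
  have hw0 : 0 < w := hw₀.trans_le hw
  have hη0 : 0 < η := by linarith [hη.1]
  have hh0 := hh.1
  have hd : 0 < h ^ ((1:ℝ)/3) := Real.rpow_pos_of_pos hh.1 _
  have hd1 : h ^ ((1:ℝ)/3) ≤ 1 := Real.rpow_le_one hh.1.le hh.2 (by norm_num)
  have hd3 : h = (h ^ ((1:ℝ)/3)) ^ 3 := by
    rw [← Real.rpow_natCast, ← Real.rpow_mul hh0.le]
    norm_num
  have hm : 0 < η ^ ((1:ℝ)/3) := Real.rpow_pos_of_pos hη0 _
  have hm2 : η ^ ((1:ℝ)/3) ≤ 2 := by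
    have h3 : η = (η ^ ((1:ℝ)/3)) ^ 3 := by
      rw [← Real.rpow_natCast, ← Real.rpow_mul hη0.le]
      norm_num
    by_contra! hlt
    have : (2:ℝ) ^ 3 < (η ^ ((1:ℝ)/3)) ^ 3 := by gcongr
    rw [← h3] at this
    linarith [hη.2]
  have hp : (η / h) ^ ((1:ℝ)/3) = η ^ ((1:ℝ)/3) / h ^ ((1:ℝ)/3) :=
    Real.div_rpow hη0.le hh0.le _
  unfold dispersionD2
  rw [hp]
  rw [show h ^ 2 = ((h ^ ((1:ℝ)/3)) ^ 3) ^ 2 by rw [← hd3]]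
  generalize h ^ ((1:ℝ)/3) = d at *
  generalize η ^ ((1:ℝ)/3) = m at *
  have hr2 : 0 < (m / d) ^ 2 + w := by positivity
  have hr := Real.sqrt_pos.2 hr2
  have hsq := Real.sq_sqrt hr2.le
  have hrd : √((m / d) ^ 2 + w) * d ≤ K * √w := by
    rw [hK, ← Real.sqrt_mul (by positivity)]
    nth_rewrite 2 [← Real.sqrt_sq hd.le]
    rw [← Real.sqrt_mul (by positivity)]
    apply Real.sqrt_le_sqrt
    have e : ((m / d) ^ 2 + w) * d ^ 2 = m ^ 2 + w * d ^ 2 := by field_simp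
    rw [e]
    have h1 : 1 ≤ w / w₀ := (one_le_div hw₀).2 hw
    have h2 : w * d ^ 2 ≤ w * 1 := by
      gcongr
      exact pow_le_one₀ hd.le hd1
    have h3 : (4 / w₀ + 1) * w = 4 * (w / w₀) + w := by ring
    nlinarith
  generalize √((m / d) ^ 2 + w) = r at *
  have hsw : √w ^ 2 = w := Real.sq_sqrt hw0.le
  have hswp : 0 < √w := Real.sqrt_pos.2 hw0
  have e : -(-(w * ((m / d) ^ 2 + 2 * w)) / (9 * (m / d) ^ 4 * r ^ 3) / (d ^ 3) ^ 2) =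
      w * (r ^ 2 + w) / (9 * m ^ 4 * r ^ 3 * d ^ 2) := by
    rw [hsq]
    field_simp
    ring
  rw [e]
  calc 1 / (144 * K) * √w / d = w / (9 * 2 ^ 4 * (K * √w) * d) := by
        nth_rewrite 2 [← hsw]
        field_simp
        norm_num
    _ ≤ w / (9 * m ^ 4 * (r * d) * d) := by gcongr
    _ = w * r ^ 2 / (9 * m ^ 4 * r ^ 3 * d ^ 2) := by field_simp
    _ ≤ _ := by
        gcongr
        linarith

theorem continuousOn_dispersionD2 {w : ℝ} (hw : 0 < w) :
    ContinuousOn (dispersionD2 w) (Set.Ioi 0) := by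
  have hp : ContinuousOn (fun θ : ℝ => θ ^ ((1:ℝ)/3)) (Set.Ioi 0) := fun θ hθ =>
    (hasDerivAt_cbrt hθ).continuousAt.continuousWithinAt
  unfold dispersionD2
  refine ContinuousOn.div (by fun_prop) (by fun_prop) fun θ hθ => ?_
  have : 0 < θ ^ ((1:ℝ)/3) := Real.rpow_pos_of_pos hθ _
  have hr := Real.sqrt_pos.2 (by positivity : 0 < (θ ^ ((1:ℝ)/3)) ^ 2 + w)
  positivity

theorem intervalIntegral_abs_deriv_mul_comp_le {A A' b b' s s' : ℝ → ℝ} {α β C V M M' : ℝ}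
    (hαβ : α ≤ β) (hA : ∀ x, HasDerivAt A (A' x) x) (hA' : Continuous A')
    (hb : ContinuousOn b (Set.Icc α β)) (hb' : ContinuousOn b' (Set.Icc α β))
    (hs : ∀ x ∈ Set.Icc α β, HasDerivAt s (s' x) x) (hs' : ContinuousOn s' (Set.Icc α β))
    (hs0 : ∀ x ∈ Set.Icc α β, 0 ≤ s' x)
    (hC : ∀ x, |A x| ≤ C) (hM : ∀ x ∈ Set.Icc α β, |b x| ≤ M)
    (hM' : ∀ x ∈ Set.Icc α β, |b' x| ≤ M') (hM0 : 0 ≤ M)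
    (hV : ∫ z in (s α)..(s β), |A' z| ≤ V) :
    ∫ x in α..β, |b' x * A (s x) + b x * (A' (s x) * s' x)| ≤ M' * C * (β - α) + M * V := by
  have hu : Set.uIcc α β = Set.Icc α β := Set.uIcc_of_le hαβ
  have cA : Continuous A := continuous_iff_continuousAt.2 fun s => (hA s).continuousAt
  have cs : ContinuousOn s (Set.Icc α β) := fun x hx => (hs x hx).continuousAt.continuousWithinAt
  have cAs : ContinuousOn (fun x => A (s x)) (Set.Icc α β) := cA.comp_continuousOn cs
  have cA's : ContinuousOn (fun x => A' (s x)) (Set.Icc α β) := hA'.comp_continuousOn cs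
  have i1 : IntervalIntegrable (fun x => |b' x * A (s x) + b x * (A' (s x) * s' x)|)
      volume α β := ContinuousOn.intervalIntegrable
    (by rw [hu]; exact ((hb'.mul cAs).add (hb.mul (cA's.mul hs'))).abs)
  have i2 : IntervalIntegrable (fun x => M * (|A' (s x)| * s' x)) volume α β :=
    ContinuousOn.intervalIntegrable
      (by rw [hu]; exact continuousOn_const.mul (cA's.abs.mul hs'))
  have hcv : ∫ x in α..β, |A' (s x)| * s' x = ∫ z in (s α)..(s β), |A' z| :=
    intervalIntegral.integral_comp_mul_deriv'' (f := s) (f' := s') (g := fun z => |A' z|)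
      (by rw [hu]; exact cs)
      (fun x hx => by
        rw [min_eq_left hαβ, max_eq_right hαβ] at hx
        exact (hs x (Set.Ioo_subset_Icc_self hx)).hasDerivWithinAt)
      (by rw [hu]; exact hs') hA'.abs.continuousOn
  calc ∫ x in α..β, |b' x * A (s x) + b x * (A' (s x) * s' x)|
      ≤ ∫ x in α..β, (M' * C + M * (|A' (s x)| * s' x)) := by
        refine intervalIntegral.integral_mono_on hαβ i1
          (intervalIntegrable_const.add i2) fun x hx => ?_
        refine (abs_add_le _ _).trans (add_le_add ?_ ?_)
        · rw [abs_mul]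
          exact mul_le_mul (hM' x hx) (hC _) (abs_nonneg _) ((abs_nonneg _).trans (hM' x hx))
        · rw [abs_mul, abs_mul, abs_of_nonneg (hs0 x hx)]
          exact mul_le_mul_of_nonneg_right (hM x hx)
            (mul_nonneg (abs_nonneg _) (hs0 x hx))
    _ = M' * C * (β - α) + M * ∫ z in (s α)..(s β), |A' z| := by
        rw [intervalIntegral.integral_add intervalIntegrable_const i2,
          intervalIntegral.integral_const_mul M, hcv, intervalIntegral.integral_const, smul_eq_mul]
        ring
    _ ≤ _ := by gcongr

/-- Dispersive decay of the oscillatory integral defining a gallery mode, uniformly in the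
mode index and in the space variables. -/
theorem gallery_oscillatory_decay {A A' : ℝ → ℝ} (hA : ∀ x, HasDerivAt A (A' x) x)
    (hA' : Continuous A') {C w₀ : ℝ} (hw₀ : 0 < w₀) (hC : 0 < C) (hCA : ∀ x, |A x| ≤ C)
    (hvar : ∀ w, w₀ ≤ w → ∀ s₁ s₂, -w ≤ s₁ → s₁ ≤ s₂ →
      ∫ z in s₁..s₂, |A' z| ≤ C * (w * √w))
    {ψ : ℝ → ℝ} (hψ : ContDiff ℝ (⊤ : ℕ∞) ψ) :
    ∃ K > 0, ∀ w, w₀ ≤ w → ∀ h ∈ Set.Ioc (0:ℝ) 1, ∀ X, 0 ≤ X → ∀ t y : ℝ,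
      ‖∫ η in (1/2 : ℝ)..(3/2), Complex.exp (Complex.I *
          ((t * √((η / h) ^ 2 + w * (η / h) ^ ((4:ℝ)/3)) + y * η / h : ℝ) : ℂ)) *
          ((ψ η * η ^ ((1:ℝ)/3) * A (η ^ ((2:ℝ)/3) * X - w) : ℝ) : ℂ)‖ ^ 4 ≤
        K * (1 + (t / (w * h ^ ((1:ℝ)/3))) ^ 2)⁻¹ := by
  have h12 : (1/2 : ℝ) ≤ 3/2 := by norm_num
  have hpos : ∀ {η : ℝ}, η ∈ Set.Icc (1/2 : ℝ) (3/2) → 0 < η := fun hη => by linarith [hη.1]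
  obtain ⟨c, hc, hcd⟩ := dispersionD2_le hw₀
  set b : ℝ → ℝ := fun η => ψ η * η ^ ((1:ℝ)/3) with hbdef
  set b' : ℝ → ℝ := fun η => deriv ψ η * η ^ ((1:ℝ)/3) +
    ψ η * (1 / (3 * (η ^ ((1:ℝ)/3)) ^ 2)) with hb'def
  have dψ : ∀ η, HasDerivAt ψ (deriv ψ η) η := fun η =>
    (hψ.differentiable (by simp) η).hasDerivAt
  have cψ' : Continuous (deriv ψ) := hψ.continuous_deriv (by simp)
  have db : ∀ η ∈ Set.Icc (1/2 : ℝ) (3/2), HasDerivAt b (b' η) η := fun η hη =>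
    (dψ η).mul (hasDerivAt_cbrt (hpos hη))
  have cb : ContinuousOn b (Set.Icc (1/2) (3/2)) := fun x hx =>
    (db x hx).continuousAt.continuousWithinAt
  have cp : ContinuousOn (fun η : ℝ => η ^ ((1:ℝ)/3)) (Set.Icc (1/2) (3/2)) := fun x hx =>
    (hasDerivAt_cbrt (hpos hx)).continuousAt.continuousWithinAt
  have cb' : ContinuousOn b' (Set.Icc (1/2) (3/2)) := by
    refine (cψ'.continuousOn.mul cp).add (hψ.continuous.continuousOn.mul
      (continuousOn_const.div (continuousOn_const.mul (cp.pow 2)) fun x hx => ?_))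
    have : 0 < x ^ ((1:ℝ)/3) := Real.rpow_pos_of_pos (hpos hx) _
    positivity
  obtain ⟨M, hMb⟩ := isCompact_Icc.exists_bound_of_continuousOn cb
  obtain ⟨M', hMb'⟩ := isCompact_Icc.exists_bound_of_continuousOn cb'
  have hI : (1/2 : ℝ) ∈ Set.Icc (1/2 : ℝ) (3/2) := Set.left_mem_Icc.2 h12
  have hM0 : 0 ≤ M := (norm_nonneg _).trans (hMb _ hI)
  have hM'0 : 0 ≤ M' := (norm_nonneg _).trans (hMb' _ hI)
  set D : ℝ := (4 * (M * C) + M' * C) / (w₀ * √w₀) + M * C with hD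
  have hD0 : 0 ≤ D := by positivity
  set K₀ : ℝ := 2 * (M * C) + 2 * (D / c) with hK₀
  have hK₀0 : 0 ≤ K₀ := by positivity
  refine ⟨2 * (K₀ ^ 4 + 1), by positivity, fun w hw h hh X hX t y => ?_⟩
  have hw0 : 0 < w := hw₀.trans_le hw
  have hh0 := hh.1
  have hd : 0 < h ^ ((1:ℝ)/3) := Real.rpow_pos_of_pos hh0 _
  set T := w * h ^ ((1:ℝ)/3) with hT
  have hT0 : 0 < T := by positivity
  set φ : ℝ → ℝ := fun η => t * √((η / h) ^ 2 + w * (η / h) ^ ((4:ℝ)/3)) + y * η / h with hφ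
  set s : ℝ → ℝ := fun η => η ^ ((2:ℝ)/3) * X - w with hs
  set f : ℝ → ℝ := fun η => b η * A (s η) with hf
  have hfb : ∀ η ∈ Set.Icc (1/2 : ℝ) (3/2), |f η| ≤ M * C := fun η hη => by
    rw [hf]
    simp only [abs_mul]
    exact mul_le_mul (hMb η hη) (hCA _) (abs_nonneg _) hM0
  change ‖∫ η in (1/2 : ℝ)..(3/2), Complex.exp (Complex.I * (φ η : ℂ)) * (f η : ℂ)‖ ^ 4 ≤ _
  have htriv : ‖∫ η in (1/2 : ℝ)..(3/2), Complex.exp (Complex.I * (φ η : ℂ)) * (f η : ℂ)‖ ≤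
      K₀ := by
    have := intervalIntegral.norm_integral_le_of_norm_le_const (a := (1/2 : ℝ)) (b := 3/2)
      (f := fun η => Complex.exp (Complex.I * (φ η : ℂ)) * (f η : ℂ)) (C := M * C)
      fun x hx => by
        rw [Set.uIoc_of_le h12] at hx
        rw [norm_mul, norm_exp_I_mul_real, one_mul, Complex.norm_real]
        exact hfb x (Set.Ioc_subset_Icc_self hx)
    refine this.trans ?_
    rw [show |(3/2 : ℝ) - 1/2| = 1 by norm_num, mul_one, hK₀]
    have : 0 ≤ M * C := by positivity
    have : 0 ≤ D / c := by positivity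
    linarith
  have hdecay : t ≠ 0 →
      ‖∫ η in (1/2 : ℝ)..(3/2), Complex.exp (Complex.I * (φ η : ℂ)) * (f η : ℂ)‖ ≤
        K₀ * √(T / |t|) := by
    intro ht
    have ht0 : 0 < |t| := abs_pos.2 ht
    set δ := √(T / |t|) with hδ
    have hδ0 : 0 < δ := Real.sqrt_pos.2 (by positivity)
    have hδ2 : δ ^ 2 = T / |t| := Real.sq_sqrt (by positivity)
    set s' : ℝ → ℝ := fun η => (2:ℝ)/3 * η ^ ((2:ℝ)/3 - 1) * X with hs'
    have ds : ∀ η ∈ Set.Icc (1/2 : ℝ) (3/2), HasDerivAt s (s' η) η := fun η hη =>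
      ((Real.hasDerivAt_rpow_const (Or.inl (hpos hη).ne')).mul_const X).sub_const w
    have cs' : ContinuousOn s' (Set.Icc (1/2) (3/2)) := by
      refine (continuousOn_const.mul ?_).mul continuousOn_const
      exact continuousOn_id.rpow_const fun x hx => Or.inl (hpos hx).ne'
    have hs'0 : ∀ η ∈ Set.Icc (1/2 : ℝ) (3/2), 0 ≤ s' η := fun η hη => by
      have := hpos hη
      positivity
    have cA : Continuous A := continuous_iff_continuousAt.2 fun s => (hA s).continuousAt
    have cs : ContinuousOn s (Set.Icc (1/2) (3/2)) := fun x hx =>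
      (ds x hx).continuousAt.continuousWithinAt
    have hV : ∫ z in (s (1/2))..(s (3/2)), |A' z| ≤ C * (w * √w) := by
      refine hvar w hw _ _ ?_ ?_
      · simp only [hs]
        have : 0 ≤ (1/2 : ℝ) ^ ((2:ℝ)/3) * X := by positivity
        linarith
      · simp only [hs]
        gcongr
    have hvarf := intervalIntegral_abs_deriv_mul_comp_le h12 hA hA' cb cb' ds cs' hs'0 hCA
      (fun x hx => hMb x hx) (fun x hx => hMb' x hx) hM0 hV
    have hd1 : ∀ η ∈ Set.Icc (1/2 : ℝ) (3/2),
        HasDerivAt φ (t * (dispersionD1 w (η / h) / h) + y / h) η := fun η hη => by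
      have h1 := (hasDerivAt_dispersion hw0 (div_pos (hpos hη) hh0)).comp η
        ((hasDerivAt_id η).div_const h)
      refine ((h1.const_mul t).add (((hasDerivAt_id η).const_mul y).div_const h)).congr_deriv ?_
      ring
    have hd2 : ∀ η ∈ Set.Icc (1/2 : ℝ) (3/2),
        HasDerivAt (fun η => t * (dispersionD1 w (η / h) / h) + y / h)
          (t * (dispersionD2 w (η / h) / h ^ 2)) η := fun η hη => by
      have h1 := (hasDerivAt_dispersionD1 hw0 (div_pos (hpos hη) hh0)).comp η
        ((hasDerivAt_id η).div_const h)
      refine (((h1.div_const h).const_mul t).add_const _).congr_deriv ?_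
      ring
    have hc2 : ContinuousOn (fun η => t * (dispersionD2 w (η / h) / h ^ 2))
        (Set.Icc (1/2) (3/2)) := by
      refine continuousOn_const.mul (ContinuousOn.div_const ?_ _)
      exact (continuousOn_dispersionD2 hw0).comp (by fun_prop)
        fun η hη => div_pos (hpos hη) hh0
    set Λ := |t| * (c * √w / h ^ ((1:ℝ)/3)) with hΛ
    have hsw : 0 < √w := Real.sqrt_pos.2 hw0
    have hΛ0 : 0 < Λ := by positivity
    have hge : (∀ η ∈ Set.Icc (1/2 : ℝ) (3/2), Λ ≤ t * (dispersionD2 w (η / h) / h ^ 2)) ∨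
        (∀ η ∈ Set.Icc (1/2 : ℝ) (3/2), Λ ≤ -(t * (dispersionD2 w (η / h) / h ^ 2))) := by
      rcases lt_or_gt_of_ne ht with h0 | h0
      · left
        intro η hη
        rw [hΛ, abs_of_neg h0]
        exact (mul_le_mul_of_nonneg_left (hcd w hw h hh η hη)
          (by linarith : 0 ≤ -t)).trans_eq (by ring)
      · right
        intro η hη
        rw [hΛ, abs_of_pos h0, ← mul_neg]
        exact mul_le_mul_of_nonneg_left (hcd w hw h hh η hη) h0.le
    have hmain := norm_integral_exp_le_of_abs_deriv2_ge h12 hd1 hd2 hc2 hΛ0 hge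
      (f := f) (f' := fun η => b' η * A (s η) + b η * (A' (s η) * s' η))
      (fun η hη => (db η hη).mul ((hA (s η)).comp η (ds η hη)))
      ((cb'.mul (cA.comp_continuousOn cs)).add
        (cb.mul ((hA'.comp_continuousOn cs).mul cs'))) hfb hδ0
    refine hmain.trans ?_
    have hnum : 4 * (M * C) + ∫ x in (1/2 : ℝ)..(3/2),
        |b' x * A (s x) + b x * (A' (s x) * s' x)| ≤ D * (w * √w) := by
      have h1 : 4 * (M * C) + M' * C ≤ (4 * (M * C) + M' * C) / (w₀ * √w₀) * (w * √w) := by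
        rw [div_mul_eq_mul_div, le_div_iff₀ (by positivity)]
        gcongr
      have h2 : D * (w * √w) = (4 * (M * C) + M' * C) / (w₀ * √w₀) * (w * √w) +
          M * (C * (w * √w)) := by
        rw [hD]
        ring
      rw [h2]
      norm_num at hvarf ⊢
      linarith
    have hq : D * (w * √w) / (Λ * δ) = D / c * δ := by
      have e : w * h ^ ((1:ℝ)/3) = δ ^ 2 * |t| := by
        rw [hδ2, ← hT]
        field_simp
      rw [div_eq_iff (by positivity), hΛ]
      have e2 : D / c * δ * (|t| * (c * √w / h ^ ((1:ℝ)/3)) * δ) =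
          D * √w * (δ ^ 2 * |t|) / h ^ ((1:ℝ)/3) := by field_simp
      rw [e2, ← e]
      field_simp
    calc _ ≤ 2 * δ * (M * C) + 2 * (D * (w * √w) / (Λ * δ)) := by gcongr
      _ = K₀ * δ := by
        rw [hq, hK₀]
        ring
  set N := ‖∫ η in (1/2 : ℝ)..(3/2), Complex.exp (Complex.I * (φ η : ℂ)) * (f η : ℂ)‖ with hN
  have hN0 : 0 ≤ N := norm_nonneg _
  rw [← div_eq_mul_inv, le_div_iff₀ (by positivity)]
  have hA1 : N ^ 4 ≤ K₀ ^ 4 := by gcongr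
  have hA2 : N ^ 4 * (t / T) ^ 2 ≤ K₀ ^ 4 := by
    by_cases ht : t = 0
    · simp [ht]
      positivity
    · have ht0 : 0 < |t| := abs_pos.2 ht
      have h1 : N ^ 4 ≤ (K₀ * √(T / |t|)) ^ 4 := by
        gcongr
        exact hdecay ht
      have h2 : (K₀ * √(T / |t|)) ^ 4 = K₀ ^ 4 * (T / |t|) ^ 2 := by
        rw [mul_pow, show √(T / |t|) ^ 4 = (√(T / |t|) ^ 2) ^ 2 by ring,
          Real.sq_sqrt (by positivity)]
      calc N ^ 4 * (t / T) ^ 2 ≤ K₀ ^ 4 * (T / |t|) ^ 2 * (t / T) ^ 2 := by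
            rw [← h2]
            gcongr
        _ = K₀ ^ 4 := by
            rw [div_pow, div_pow, sq_abs]
            field_simp
  linarith

open scoped FourierTransform ContDiff in
theorem lintegral_fourier_sq {g : ℝ → ℂ} (hg : ContDiff ℝ ∞ g) (hc : HasCompactSupport g)
    {h : ℝ} (hh : 0 < h) :
    ∫⁻ y : ℝ, ‖∫ η : ℝ, Complex.exp (Complex.I * ((y * η / h : ℝ) : ℂ)) * g η‖ₑ ^ 2 =
      ENNReal.ofReal (2 * π * h) * ∫⁻ η : ℝ, ‖g η‖ₑ ^ 2 := by
  set S : SchwartzMap ℝ ℂ := hc.toSchwartzMap hg with hS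
  have hSg : ∀ η, S η = g η := fun η => rfl
  have hsq : ∀ f : SchwartzMap ℝ ℂ, Integrable (fun x => ‖f x‖ ^ 2) := fun f =>
    (memLp_two_iff_integrable_sq_norm f.continuous.aestronglyMeasurable).1 (f.memLp 2)
  have hconv : ∀ {F : ℝ → ℂ}, Integrable (fun x => ‖F x‖ ^ 2) →
      ∫⁻ x, ‖F x‖ₑ ^ 2 = ENNReal.ofReal (∫ x, ‖F x‖ ^ 2) := fun {F} hF => by
    rw [ofReal_integral_eq_lintegral_ofReal hF (Eventually.of_forall fun x => by positivity)]
    refine lintegral_congr fun x => ?_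
    rw [ENNReal.ofReal_pow (norm_nonneg _), ofReal_norm]
  have hF : ∀ y : ℝ, ∫ η : ℝ, Complex.exp (Complex.I * ((y * η / h : ℝ) : ℂ)) * g η =
      (𝓕 S) ((-(2 * π * h)⁻¹) * y) := by
    intro y
    rw [SchwartzMap.fourier_coe, Real.fourier_real_eq_integral_exp_smul]
    refine integral_congr_ae (Eventually.of_forall fun η => ?_)
    simp only [hSg, smul_eq_mul]
    congr 2
    push_cast
    have : (π : ℂ) ≠ 0 := by exact_mod_cast Real.pi_ne_zero
    have : (h : ℂ) ≠ 0 := by exact_mod_cast hh.ne'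
    field_simp
  have hne : -(2 * π * h)⁻¹ ≠ 0 := by
    have := Real.pi_pos
    have : (2 * π * h)⁻¹ ≠ 0 := by positivity
    simpa using this
  have i1 : Integrable (fun y => ‖(𝓕 S) ((-(2 * π * h)⁻¹) * y)‖ ^ 2) :=
    (hsq (𝓕 S)).comp_mul_left' hne
  have hscale : ∫ y, ‖(𝓕 S) ((-(2 * π * h)⁻¹) * y)‖ ^ 2 =
      |(-(2 * π * h)⁻¹)⁻¹| • ∫ y, ‖(𝓕 S) y‖ ^ 2 :=
    Measure.integral_comp_mul_left (fun y => ‖(𝓕 S) y‖ ^ 2) _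
  simp_rw [hF]
  rw [hconv i1, hscale,
    SchwartzMap.integral_norm_sq_fourier, hconv (F := g) (hsq S), smul_eq_mul,
    ENNReal.ofReal_mul (abs_nonneg _)]
  congr 2
  rw [abs_inv, abs_neg, abs_inv, inv_inv, abs_of_pos]
  have := Real.pi_pos
  positivity

theorem norm_ek_sq {Ai : ℂ → ℂ} (hAi_real : ∀ x : ℝ, (Ai x).im = 0) (ω : ℕ → ℝ) (k : ℕ)
    {θ : ℝ} (hθ : 0 < θ) (x : ℝ) :
    ‖ek Ai ω k θ x‖ ^ 2 = θ ^ ((2:ℝ)/3) * (Ai ((θ ^ ((2:ℝ)/3) * x - ω k : ℝ))).re ^ 2 /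
      ∫ x' in Set.Ioi (0:ℝ), (Ai ((x' - ω k : ℝ))).re ^ 2 := by
  have hN : 0 ≤ ∫ x' in Set.Ioi (0:ℝ), (Ai ((x' - ω k : ℝ))).re ^ 2 :=
    integral_nonneg fun _ => sq_nonneg _
  have hA : ∀ s : ℝ, Ai s = ((Ai s).re : ℂ) := fun s =>
    Complex.ext rfl (by simpa using hAi_real s)
  unfold ek
  rw [hA]
  rw [norm_div, norm_mul, Complex.norm_real, Complex.norm_real, Complex.norm_real, div_pow,
    mul_pow, Real.norm_eq_abs, Real.norm_eq_abs, Real.norm_eq_abs, sq_abs, sq_abs, sq_abs,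
    Real.sq_sqrt hN, ← Real.rpow_natCast, ← Real.rpow_mul hθ.le]
  norm_num

theorem lintegral_ek_sq {Ai : ℂ → ℂ} (hAi_real : ∀ x : ℝ, (Ai x).im = 0) {ω : ℕ → ℝ} {k : ℕ}
    (hint : IntegrableOn (fun x' : ℝ => (Ai ((x' - ω k : ℝ))).re ^ 2) (Set.Ioi 0))
    (hpos : 0 < ∫ x' in Set.Ioi (0:ℝ), (Ai ((x' - ω k : ℝ))).re ^ 2) {θ : ℝ} (hθ : 0 < θ) :
    ∫⁻ x in Set.Ioi (0:ℝ), ‖ek Ai ω k θ x‖ₑ ^ 2 = 1 := by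
  have hp : 0 < θ ^ ((2:ℝ)/3) := Real.rpow_pos_of_pos hθ _
  have hi : IntegrableOn (fun x : ℝ => (Ai ((θ ^ ((2:ℝ)/3) * x - ω k : ℝ))).re ^ 2)
      (Set.Ioi 0) := by
    have := integrableOn_Ioi_comp_mul_left_iff
      (fun x' : ℝ => (Ai ((x' - ω k : ℝ))).re ^ 2) 0 hp
    exact this.2 (by simpa using hint)
  have hval := integral_comp_mul_left_Ioi (fun x' : ℝ => (Ai ((x' - ω k : ℝ))).re ^ 2) 0 hp
  have e : ∀ x, ‖ek Ai ω k θ x‖ₑ ^ 2 = ENNReal.ofReal (‖ek Ai ω k θ x‖ ^ 2) := fun x => by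
    rw [ENNReal.ofReal_pow (norm_nonneg _), ofReal_norm]
  simp_rw [e, norm_ek_sq hAi_real ω k hθ]
  rw [← ofReal_integral_eq_lintegral_ofReal ((hi.const_mul _).div_const _)
    (Eventually.of_forall fun x => by positivity), integral_div, integral_const_mul, hval,
    mul_zero, smul_eq_mul, mul_inv_cancel_left₀ hp.ne', div_self hpos.ne', ENNReal.ofReal_one]

theorem continuous_ek {Ai : ℂ → ℂ} (hAi : Continuous Ai) (ω : ℕ → ℝ) (k : ℕ) :
    Continuous fun p : ℝ × ℝ => ek Ai ω k p.1 p.2 := by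
  have h1 : Continuous fun p : ℝ × ℝ => p.1 ^ ((1:ℝ)/3) :=
    (Real.continuous_rpow_const (by norm_num)).comp continuous_fst
  have h2 : Continuous fun p : ℝ × ℝ => p.1 ^ ((2:ℝ)/3) :=
    (Real.continuous_rpow_const (by norm_num)).comp continuous_fst
  unfold ek
  refine Continuous.div_const ?_ _
  exact (Complex.continuous_ofReal.comp h1).mul (hAi.comp (Complex.continuous_ofReal.comp
    ((h2.mul continuous_snd).sub continuous_const)))

theorem continuous_lamk (ω : ℕ → ℝ) (k : ℕ) : Continuous (lamk ω k) := by
  have h2 : Continuous fun p : ℝ => p ^ ((4:ℝ)/3) := Real.continuous_rpow_const (by norm_num)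
  unfold lamk
  fun_prop

theorem stronglyMeasurable_galleryMode {Ai : ℂ → ℂ} (hAi : Continuous Ai) (ω : ℕ → ℝ)
    {ψ : ℝ → ℝ} (hψ : Continuous ψ) (k : ℕ) (h t : ℝ) :
    StronglyMeasurable fun p : ℝ × ℝ => galleryMode Ai ω ψ k h t p.1 p.2 := by
  have h1 := continuous_lamk ω k
  have h2 : Continuous fun p : (ℝ × ℝ) × ℝ => ek Ai ω k (p.2 / h) p.1.1 :=
    (continuous_ek hAi ω k).comp (by fun_prop : Continuous fun p : (ℝ × ℝ) × ℝ =>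
      (p.2 / h, p.1.1))
  unfold galleryMode
  refine StronglyMeasurable.const_mul ?_ _
  refine StronglyMeasurable.integral_prod_right' (f := fun p : (ℝ × ℝ) × ℝ =>
    Complex.exp (Complex.I * ((t * Real.sqrt (lamk ω k (p.2/h)) : ℝ) : ℂ)) *
    Complex.exp (Complex.I * ((p.1.2 * p.2 / h : ℝ) : ℂ)) *
    ((ψ p.2 : ℝ) : ℂ) * ek Ai ω k (p.2/h) p.1.1) ?_
  refine Continuous.stronglyMeasurable ?_
  fun_prop

theorem contDiff_gallery_amplitude {Ai : ℂ → ℂ} (hAi : Differentiable ℂ Ai) {ω : ℕ → ℝ} {k : ℕ}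
    (hω : 0 < ω k) {ψ : ℝ → ℝ} (hψ : ContDiff ℝ (⊤ : ℕ∞) ψ)
    (hψs : tsupport ψ ⊆ Set.Icc (1/2 : ℝ) (3/2)) {h : ℝ} (hh : 0 < h) (t x : ℝ) :
    ContDiff ℝ (⊤ : ℕ∞) fun η : ℝ =>
      Complex.exp (Complex.I * ((t * Real.sqrt (lamk ω k (η/h)) : ℝ) : ℂ)) *
        ((ψ η : ℝ) : ℂ) * ek Ai ω k (η/h) x := by
  rw [contDiff_iff_contDiffAt]
  intro η
  by_cases hη : η ∈ tsupport ψ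
  · have hη0 : 0 < η := by linarith [(hψs hη).1]
    have hθ : 0 < η / h := div_pos hη0 hh
    have d1 : ContDiffAt ℝ (⊤ : ℕ∞) (fun η : ℝ => η / h) η := by fun_prop
    have dr : ∀ p : ℝ, ContDiffAt ℝ (⊤ : ℕ∞) (fun η : ℝ => (η / h) ^ p) η := fun p =>
      d1.rpow_const_of_ne hθ.ne'
    have dl : ContDiffAt ℝ (⊤ : ℕ∞) (fun η : ℝ => t * Real.sqrt (lamk ω k (η/h))) η := by
      refine contDiffAt_const.mul (ContDiffAt.sqrt ?_ ?_)
      · exact (d1.pow 2).add (contDiffAt_const.mul (dr _))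
      · have : 0 < (η / h) ^ ((4:ℝ)/3) := Real.rpow_pos_of_pos hθ _
        unfold lamk
        positivity
    have hof : ∀ {f : ℝ → ℝ}, ContDiffAt ℝ (⊤ : ℕ∞) f η →
        ContDiffAt ℝ (⊤ : ℕ∞) (fun η => (f η : ℂ)) η :=
      fun hf => Complex.ofRealCLM.contDiff.contDiffAt.comp η hf
    have dA : ContDiff ℝ (⊤ : ℕ∞) Ai := (hAi.contDiff (n := (⊤ : ℕ∞))).restrict_scalars ℝ
    refine ((contDiffAt_const.mul (hof dl)).cexp.mul (hof hψ.contDiffAt)).mul ?_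
    unfold ek
    exact ((hof (dr _)).mul (dA.contDiffAt.comp η
      (hof (((dr _).mul contDiffAt_const).sub contDiffAt_const)))).div_const _
  · have h0 : ψ =ᶠ[nhds η] 0 := notMem_tsupport_iff_eventuallyEq.1 hη
    refine (contDiffAt_const (c := (0:ℂ))).congr_of_eventuallyEq ?_
    filter_upwards [h0] with z hz
    simp [hz]

theorem lintegral_galleryMode_sq {Ai : ℂ → ℂ} (hAi : Differentiable ℂ Ai)
    (hAi_real : ∀ x : ℝ, (Ai x).im = 0) {ω : ℕ → ℝ} {k : ℕ} (hω : 0 < ω k)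
    (hint : IntegrableOn (fun x' : ℝ => (Ai ((x' - ω k : ℝ))).re ^ 2) (Set.Ioi 0))
    (hpos : 0 < ∫ x' in Set.Ioi (0:ℝ), (Ai ((x' - ω k : ℝ))).re ^ 2)
    {ψ : ℝ → ℝ} (hψ : ContDiff ℝ (⊤ : ℕ∞) ψ)
    (hψs : tsupport ψ ⊆ Set.Icc (1/2 : ℝ) (3/2)) {h : ℝ} (hh : 0 < h) (t : ℝ) :
    ∫⁻ p, ‖galleryMode Ai ω ψ k h t p.1 p.2‖ₑ ^ 2 ∂μΩ =
      ENNReal.ofReal (2 * π / h * ∫ η, ψ η ^ 2) := by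
  have hpi := Real.pi_pos
  have hcs : HasCompactSupport ψ := HasCompactSupport.of_support_subset_isCompact isCompact_Icc
    ((subset_tsupport ψ).trans hψs)
  have hmeas := stronglyMeasurable_galleryMode hAi.continuous ω hψ.continuous k h t
  have hμ : μΩ = (volume.restrict (Set.Ioi (0:ℝ))).prod volume := by
    rw [μΩ, Measure.volume_eq_prod, ← Measure.prod_restrict, Measure.restrict_univ]
  have hx : ∀ x : ℝ, ∫⁻ y, ‖galleryMode Ai ω ψ k h t x y‖ₑ ^ 2 =
      ENNReal.ofReal (2 * π / h) * ∫⁻ η, ‖ψ η‖ₑ ^ 2 * ‖ek Ai ω k (η/h) x‖ₑ ^ 2 := by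
    intro x
    have hg := contDiff_gallery_amplitude hAi hω hψ hψs hh t x
    set g : ℝ → ℂ := fun η : ℝ =>
      Complex.exp (Complex.I * ((t * Real.sqrt (lamk ω k (η/h)) : ℝ) : ℂ)) *
        ((ψ η : ℝ) : ℂ) * ek Ai ω k (η/h) x with hgdef
    have hgc : HasCompactSupport g := hcs.mono fun η hη hη0 => hη (by simp [hgdef, hη0])
    have e1 : ∀ y, galleryMode Ai ω ψ k h t x y =
        ((1/h : ℝ) : ℂ) * ∫ η : ℝ, Complex.exp (Complex.I * ((y * η / h : ℝ) : ℂ)) * g η := by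
      intro y
      unfold galleryMode
      congr 2
      ext η
      simp only [hgdef]
      ring
    simp_rw [e1, enorm_mul, mul_pow]
    rw [lintegral_const_mul' _ _ (by simp), lintegral_fourier_sq hg hgc hh, ← mul_assoc]
    congr 1
    · rw [← ofReal_norm, Complex.norm_real, Real.norm_of_nonneg (by positivity),
        ← ENNReal.ofReal_pow (by positivity), ← ENNReal.ofReal_mul (by positivity)]
      congr 1
      field_simp
    · refine lintegral_congr fun η => ?_
      have hψn : ‖((ψ η : ℝ) : ℂ)‖ₑ = ‖ψ η‖ₑ := by
        rw [← ofReal_norm, Complex.norm_real, ofReal_norm]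
      have hen : ‖Complex.exp (Complex.I * ((t * Real.sqrt (lamk ω k (η/h)) : ℝ) : ℂ))‖ₑ = 1 := by
        rw [← ofReal_norm, norm_exp_I_mul_real, ENNReal.ofReal_one]
      rw [hgdef]
      simp only
      rw [enorm_mul, enorm_mul, hen, one_mul, mul_pow, hψn]
  have hek : Continuous fun p : ℝ × ℝ => ek Ai ω k (p.2 / h) p.1 :=
    (continuous_ek hAi.continuous ω k).comp
      (by fun_prop : Continuous fun p : ℝ × ℝ => (p.2 / h, p.1))
  rw [hμ, lintegral_prod _ (hmeas.enorm.pow_const 2).aemeasurable]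
  simp_rw [hx]
  rw [lintegral_const_mul' _ _ ENNReal.ofReal_ne_top, lintegral_lintegral_swap]
  · rw [ENNReal.ofReal_mul (by positivity)]
    congr 1
    rw [ofReal_integral_eq_lintegral_ofReal]
    · refine lintegral_congr fun η => ?_
      rw [lintegral_const_mul' _ _ (by simp)]
      by_cases hη : ψ η = 0
      · simp [hη]
      · have hη0 : 0 < η := by linarith [(hψs (subset_tsupport ψ hη)).1]
        rw [lintegral_ek_sq hAi_real hint hpos (div_pos hη0 hh), mul_one, ← ofReal_norm,
          ← ENNReal.ofReal_pow (norm_nonneg _), Real.norm_eq_abs, sq_abs]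
    · exact (hψ.continuous.pow 2).integrable_of_hasCompactSupport
        (hcs.mono fun η hη hη0 => hη (by simp [hη0]))
    · exact Eventually.of_forall fun η => sq_nonneg _
  · refine Measurable.aemeasurable ?_
    have m1 : Measurable fun p : ℝ × ℝ => ‖ψ p.2‖ₑ ^ 2 :=
      ((hψ.continuous.comp continuous_snd).measurable.enorm).pow_const 2
    have m2 : Measurable fun p : ℝ × ℝ => ‖ek Ai ω k (p.2 / h) p.1‖ₑ ^ 2 :=
      hek.measurable.enorm.pow_const 2
    exact m1.mul m2

theorem eLpNorm_le_interpolate_two {α : Type*} [MeasurableSpace α] {μ : Measure α} {f : α → ℂ}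
    (hf : AEStronglyMeasurable f μ) {B : ℝ≥0∞} (hB : ∀ᵐ x ∂μ, ‖f x‖ₑ ≤ B)
    {r : ℝ≥0∞} (hr : 2 ≤ r) :
    eLpNorm f r μ ≤ B ^ (1 - 2 * (r⁻¹).toReal) * eLpNorm f 2 μ ^ (2 * (r⁻¹).toReal) := by
  have hr0 : r ≠ 0 := (lt_of_lt_of_le (by norm_num) hr).ne'
  by_cases htop : r = ∞
  · subst htop
    simpa [eLpNormEssSup] using (essSup_le_of_ae_le B hB : essSup (fun x => ‖f x‖ₑ) μ ≤ B)
  have hR : 2 ≤ r.toReal := by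
    simpa using (ENNReal.toReal_le_toReal (by simp) htop).2 hr
  set R := r.toReal with hRdef
  have hR0 : 0 < R := by linarith
  rw [eLpNorm_eq_lintegral_rpow_enorm_toReal hr0 htop,
    eLpNorm_eq_lintegral_rpow_enorm_toReal two_ne_zero ENNReal.ofNat_ne_top, ENNReal.toReal_inv,
    ← hRdef, ENNReal.toReal_ofNat, ← ENNReal.rpow_mul]
  have e1 : 1 / (2:ℝ) * (2 * R⁻¹) = 1 / R := by field_simp
  have e2 : 1 - 2 * R⁻¹ = (R - 2) * (1 / R) := by field_simp
  rw [e1, e2, ENNReal.rpow_mul, ← ENNReal.mul_rpow_of_nonneg _ _ (by positivity)]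
  refine ENNReal.rpow_le_rpow ?_ (by positivity)
  rw [← lintegral_const_mul'' _ (hf.enorm.pow_const _)]
  refine lintegral_mono_ae ?_
  filter_upwards [hB] with x hx
  calc ‖f x‖ₑ ^ R = ‖f x‖ₑ ^ (R - 2) * ‖f x‖ₑ ^ (2:ℝ) := by
        rw [← ENNReal.rpow_add_of_nonneg _ _ (by linarith) (by norm_num)]
        congr 1
        ring
    _ ≤ _ := by
        gcongr

theorem lintegral_eLpNorm_rpow_le {α : Type*} [MeasurableSpace α] {μ : Measure α}
    {u : ℝ → α → ℂ} (hu : ∀ t, AEStronglyMeasurable (u t) μ) {G : ℝ → ℝ≥0∞} (hG : Measurable G)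
    (hGu : ∀ t, ∀ᵐ x ∂μ, ‖u t x‖ₑ ^ 4 ≤ G t) {U : ℝ≥0∞} (hU : ∀ t, eLpNorm (u t) 2 μ = U)
    {q : ℝ} (hq : 4 ≤ q) {r : ℝ≥0∞} (hr : 2 ≤ r)
    (hadm : 1 / q = (1 / 2) * (1 / 2 - (r⁻¹).toReal)) :
    ∫⁻ t, eLpNorm (u t) r μ ^ q ≤ (∫⁻ t, G t) * U ^ (q - 4) := by
  have hq0 : 0 < q := by linarith
  rw [← lintegral_mul_const _ hG]
  refine lintegral_mono fun t => ?_
  have hB : ∀ᵐ x ∂μ, ‖u t x‖ₑ ≤ G t ^ ((1:ℝ)/4) := by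
    filter_upwards [hGu t] with x hx
    refine le_trans (le_of_eq ?_) (ENNReal.rpow_le_rpow hx (by norm_num))
    rw [← ENNReal.rpow_natCast, ← ENNReal.rpow_mul]
    norm_num
  refine (ENNReal.rpow_le_rpow (eLpNorm_le_interpolate_two (hu t) hB hr) hq0.le).trans ?_
  have e1 : 1 - 2 * (r⁻¹).toReal = 4 / q := by
    have : 4 / q = 4 * (1 / q) := by ring
    rw [this, hadm]
    ring
  have e2 : 2 * (r⁻¹).toReal = 1 - 4 / q := by linarith
  rw [e1, e2, hU, ENNReal.mul_rpow_of_nonneg _ _ hq0.le, ← ENNReal.rpow_mul, ← ENNReal.rpow_mul,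
    ← ENNReal.rpow_mul]
  have e3 : 1 / 4 * (4 / q * q) = 1 := by field_simp
  have e4 : (1 - 4 / q) * q = q - 4 := by field_simp
  rw [e3, e4, ENNReal.rpow_one]

theorem lintegral_const_mul_inv_one_add_div_sq {M T : ℝ} (hM : 0 ≤ M) (hT : 0 < T) :
    ∫⁻ t : ℝ, ENNReal.ofReal (M * (1 + (t / T) ^ 2)⁻¹) = ENNReal.ofReal (M * (T * π)) := by
  have hi : Integrable fun t : ℝ => (1 + (t / T) ^ 2)⁻¹ :=
    integrable_inv_one_add_sq.comp_div hT.ne'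
  have hval : ∫ t : ℝ, (1 + (t / T) ^ 2)⁻¹ = |T| • ∫ t : ℝ, (1 + t ^ 2)⁻¹ :=
    Measure.integral_comp_div (fun t : ℝ => (1 + t ^ 2)⁻¹) T
  rw [← ofReal_integral_eq_lintegral_ofReal (hi.const_mul M)
    (Eventually.of_forall fun t => by positivity), integral_const_mul, hval,
    integral_univ_inv_one_add_sq, abs_of_pos hT, smul_eq_mul]

theorem integral_Ioi_comp_sub_right (f : ℝ → ℝ) (w : ℝ) :
    ∫ x in Set.Ioi (0:ℝ), f (x - w) = ∫ x in Set.Ioi (-w), f x := by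
  have := (measurePreserving_sub_right volume w).setIntegral_preimage_emb
    (MeasurableEquiv.subRight w).measurableEmbedding f (Set.Ioi (-w))
  simpa using this

theorem integrableOn_Ioi_comp_sub_right_iff {f : ℝ → ℝ} {w : ℝ} :
    IntegrableOn (fun x => f (x - w)) (Set.Ioi 0) ↔ IntegrableOn f (Set.Ioi (-w)) := by
  have := (measurePreserving_sub_right volume w).integrableOn_comp_preimage
    (MeasurableEquiv.subRight w).measurableEmbedding (f := f) (s := Set.Ioi (-w))
  simpa [Function.comp_def] using this

theorem integrableOn_Ioi_iff_of_continuous {f : ℝ → ℝ} (hf : Continuous f) (a b : ℝ) :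
    IntegrableOn f (Set.Ioi a) ↔ IntegrableOn f (Set.Ioi b) := by
  have key : ∀ a b : ℝ, IntegrableOn f (Set.Ioi a) → IntegrableOn f (Set.Ioi b) := by
    intro a b h
    have h1 : IntegrableOn f (Set.Ioc b a) :=
      (hf.continuousOn.integrableOn_Icc).mono_set Set.Ioc_subset_Icc_self
    refine (h1.union h).mono_set fun x hx => ?_
    rcases le_or_gt x a with hxa | hxa
    · exact Or.inl ⟨hx, hxa⟩
    · exact Or.inr hxa
  exact ⟨key a b, key b a⟩

theorem galleryMode_eq_intervalIntegral {Ai : ℂ → ℂ} (hAi_real : ∀ x : ℝ, (Ai x).im = 0)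
    (ω : ℕ → ℝ) (k : ℕ) {ψ : ℝ → ℝ} (hψs : tsupport ψ ⊆ Set.Icc (1/2 : ℝ) (3/2))
    {h : ℝ} (hh : 0 < h) (t x y : ℝ) :
    galleryMode Ai ω ψ k h t x y =
      ((h⁻¹ * (h ^ ((1:ℝ)/3))⁻¹ *
        (√(∫ x' in Set.Ioi (0:ℝ), (Ai ((x' - ω k : ℝ))).re ^ 2))⁻¹ : ℝ) : ℂ) *
      ∫ η in (1/2 : ℝ)..(3/2), Complex.exp (Complex.I *
          ((t * √((η / h) ^ 2 + ω k * (η / h) ^ ((4:ℝ)/3)) + y * η / h : ℝ) : ℂ)) *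
          ((ψ η * η ^ ((1:ℝ)/3) *
            (Ai (η ^ ((2:ℝ)/3) * (x / h ^ ((2:ℝ)/3)) - ω k : ℝ)).re : ℝ) : ℂ) := by
  have hA : ∀ s : ℝ, Ai s = ((Ai s).re : ℂ) := fun s =>
    Complex.ext rfl (by simpa using hAi_real s)
  set N := √(∫ x' in Set.Ioi (0:ℝ), (Ai ((x' - ω k : ℝ))).re ^ 2) with hN
  unfold galleryMode
  rw [← setIntegral_eq_integral_of_forall_compl_eq_zero (s := Set.Icc (1/2 : ℝ) (3/2)),
    integral_Icc_eq_integral_Ioc, ← intervalIntegral.integral_of_le (by norm_num),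
    ← intervalIntegral.integral_const_mul, ← intervalIntegral.integral_const_mul]
  · refine intervalIntegral.integral_congr fun η hη => ?_
    rw [Set.uIcc_of_le (by norm_num)] at hη
    have hη0 : 0 ≤ η := by linarith [hη.1]
    have e1 : (η / h) ^ ((1:ℝ)/3) = η ^ ((1:ℝ)/3) * (h ^ ((1:ℝ)/3))⁻¹ := by
      rw [Real.div_rpow hη0 hh.le, div_eq_mul_inv]
    have e2 : (η / h) ^ ((2:ℝ)/3) * x = η ^ ((2:ℝ)/3) * (x / h ^ ((2:ℝ)/3)) := by
      rw [Real.div_rpow hη0 hh.le]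
      ring
    simp only [ek, lamk, ← hN]
    rw [e1, e2, hA, Complex.ofReal_re]
    rw [Complex.ofReal_add, mul_add, Complex.exp_add, one_div]
    push_cast
    ring
  · intro η hη
    have : ψ η = 0 := by
      by_contra h0
      exact hη (hψs (subset_tsupport ψ h0))
    simp [this]

theorem enorm_galleryMode_pow_four_le {Ai : ℂ → ℂ} (hAi_real : ∀ x : ℝ, (Ai x).im = 0)
    {ω : ℕ → ℝ} {k : ℕ} {ψ : ℝ → ℝ} (hψs : tsupport ψ ⊆ Set.Icc (1/2 : ℝ) (3/2)) {h D : ℝ}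
    (hh : 0 < h) {t : ℝ} (hD : ∀ X, 0 ≤ X → ∀ y : ℝ,
      ‖∫ η in (1/2 : ℝ)..(3/2), Complex.exp (Complex.I *
          ((t * √((η / h) ^ 2 + ω k * (η / h) ^ ((4:ℝ)/3)) + y * η / h : ℝ) : ℂ)) *
          ((ψ η * η ^ ((1:ℝ)/3) *
            (Ai (η ^ ((2:ℝ)/3) * X - ω k : ℝ)).re : ℝ) : ℂ)‖ ^ 4 ≤ D)
    {x : ℝ} (hx : 0 < x) (y : ℝ) :
    ‖galleryMode Ai ω ψ k h t x y‖ₑ ^ 4 ≤ ENNReal.ofReal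
      (h⁻¹ ^ 4 * (h ^ ((4:ℝ)/3))⁻¹ *
        (∫ x' in Set.Ioi (0:ℝ), (Ai ((x' - ω k : ℝ))).re ^ 2)⁻¹ ^ 2 * D) := by
  have hI : 0 ≤ ∫ x' in Set.Ioi (0:ℝ), (Ai ((x' - ω k : ℝ))).re ^ 2 :=
    integral_nonneg fun _ => sq_nonneg _
  have hX : 0 ≤ x / h ^ ((2:ℝ)/3) := by positivity
  rw [← ofReal_norm, ← ENNReal.ofReal_pow (norm_nonneg _)]
  refine ENNReal.ofReal_le_ofReal ?_
  rw [galleryMode_eq_intervalIntegral hAi_real ω k hψs hh, norm_mul, mul_pow, Complex.norm_real,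
    Real.norm_of_nonneg (by positivity)]
  refine mul_le_mul (le_of_eq ?_) (hD _ hX y) (by positivity) (by positivity)
  have e1 : (h ^ ((1:ℝ)/3)) ^ 4 = h ^ ((4:ℝ)/3) := by
    rw [← Real.rpow_natCast, ← Real.rpow_mul hh.le]
    norm_num
  have e2 : ∀ I : ℝ, 0 ≤ I → (√I)⁻¹ ^ 4 = I⁻¹ ^ 2 := fun I hI => by
    rw [inv_pow, inv_pow, show 4 = 2 * 2 from rfl, pow_mul, Real.sq_sqrt hI]
  rw [mul_pow, mul_pow, e2 _ hI, inv_pow (h ^ ((1:ℝ)/3)), e1]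

theorem eLpNorm_galleryMode_two {Ai : ℂ → ℂ} (hAi : Differentiable ℂ Ai)
    (hAi_real : ∀ x : ℝ, (Ai x).im = 0) {ω : ℕ → ℝ} {k : ℕ} (hω : 0 < ω k)
    (hint : IntegrableOn (fun x' : ℝ => (Ai ((x' - ω k : ℝ))).re ^ 2) (Set.Ioi 0))
    (hpos : 0 < ∫ x' in Set.Ioi (0:ℝ), (Ai ((x' - ω k : ℝ))).re ^ 2)
    {ψ : ℝ → ℝ} (hψ : ContDiff ℝ (⊤ : ℕ∞) ψ)
    (hψs : tsupport ψ ⊆ Set.Icc (1/2 : ℝ) (3/2)) {h : ℝ} (hh : 0 < h) (t : ℝ) :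
    eLpNorm (fun p : ℝ × ℝ => galleryMode Ai ω ψ k h t p.1 p.2) 2 μΩ =
      ENNReal.ofReal (2 * π / h * ∫ η, ψ η ^ 2) ^ ((1:ℝ)/2) := by
  rw [eLpNorm_eq_lintegral_rpow_enorm_toReal two_ne_zero ENNReal.ofNat_ne_top,
    ENNReal.toReal_ofNat]
  simp_rw [ENNReal.rpow_ofNat]
  rw [lintegral_galleryMode_sq hAi hAi_real hω hint hpos hψ hψs hh t]

theorem decay_constant_le {C K J w h : ℝ} (hC : 0 < C) (hK : 0 < K) (hw : 0 < w) (hh : 0 < h)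
    (hJ : √w ≤ C * J) :
    h⁻¹ ^ 4 * (h ^ ((4:ℝ)/3))⁻¹ * J⁻¹ ^ 2 * K * ((w * h ^ ((1:ℝ)/3)) * π) ≤
      π * K * C ^ 2 * h⁻¹ ^ 5 := by
  have hsw : 0 < √w := Real.sqrt_pos.2 hw
  have hJ0 : 0 < J := pos_of_mul_pos_right (hsw.trans_le hJ) hC.le
  have hwJ : J⁻¹ ^ 2 * w ≤ C ^ 2 := by
    have : w ≤ (C * J) ^ 2 := by
      rw [← Real.sq_sqrt hw.le]
      gcongr
    rw [inv_pow, inv_mul_le_iff₀ (by positivity)]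
    linarith [mul_pow C J 2]
  have e : h ^ ((4:ℝ)/3) = h * h ^ ((1:ℝ)/3) := by
    rw [show (4:ℝ)/3 = 1 + 1/3 by norm_num, Real.rpow_add hh, Real.rpow_one]
  have hpi := Real.pi_pos
  have h3 : 0 < h ^ ((1:ℝ)/3) := by positivity
  rw [e]
  calc _ = π * K * (J⁻¹ ^ 2 * w) * h⁻¹ ^ 5 := by field_simp
    _ ≤ _ := by gcongr

theorem mixed_norm_bound_of_lintegral_le {L U : ℝ≥0∞} {a V q β h : ℝ} (ha : 0 < a) (hV : 0 < V)
    (hh : 0 < h) (hq : 4 ≤ q) (hβ : β = 3 / q) (hU : U = ENNReal.ofReal (V / h) ^ ((1:ℝ)/2))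
    (hL : L ≤ ENNReal.ofReal (a * h⁻¹ ^ 5) * U ^ (q - 4)) :
    L ^ (1 / q) ≤ ENNReal.ofReal ((a / V ^ 2) ^ (1 / q) * h ^ (-β)) * U := by
  have hq0 : 0 < q := by linarith
  have hU4 : U ^ (4:ℝ) = ENNReal.ofReal ((V / h) ^ 2) := by
    rw [hU, ← ENNReal.rpow_mul, ENNReal.ofReal_pow (by positivity)]
    norm_num
  have hUq : U ^ q = ENNReal.ofReal ((V / h) ^ 2) * U ^ (q - 4) := by
    rw [← hU4, ← ENNReal.rpow_add_of_nonneg _ _ (by norm_num) (by linarith)]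
    congr 1
    ring
  have hhβ : (h ^ (-β)) ^ q = h⁻¹ ^ 3 := by
    rw [← Real.rpow_mul hh.le, hβ, neg_mul, div_mul_cancel₀ _ hq0.ne', Real.rpow_neg hh.le,
      inv_pow]
    norm_num
  have key : L ≤ (ENNReal.ofReal ((a / V ^ 2) ^ (1 / q) * h ^ (-β)) * U) ^ q := by
    rw [ENNReal.mul_rpow_of_nonneg _ _ hq0.le, ENNReal.ofReal_rpow_of_nonneg (by positivity) hq0.le,
      Real.mul_rpow (by positivity) (by positivity), hhβ, ← Real.rpow_mul (by positivity),
      one_div_mul_cancel hq0.ne', Real.rpow_one, hUq, ← mul_assoc,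
      ← ENNReal.ofReal_mul (by positivity)]
    refine hL.trans (le_of_eq ?_)
    congr 2
    field_simp
  calc L ^ (1 / q) ≤ _ := ENNReal.rpow_le_rpow key (by positivity)
    _ = _ := by rw [← ENNReal.rpow_mul, mul_one_div_cancel hq0.ne', ENNReal.rpow_one]

theorem exists_strichartz_of_forall_eq_zero {Ai : ℂ → ℂ} {ω : ℕ → ℝ} {ψ : ℝ → ℝ}
    (h0 : ∀ k h t x y, galleryMode Ai ω ψ k h t x y = 0) {q : ℝ} (hq : 4 ≤ q) (r : ℝ≥0∞)
    (β : ℝ) :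
    ∃ C > 0, ∀ k : ℕ, 1 ≤ k → ∀ h ∈ Set.Ioc (0:ℝ) 1,
      (∫⁻ t : ℝ,
          (eLpNorm (fun p : ℝ × ℝ => galleryMode Ai ω ψ k h t p.1 p.2) r μΩ) ^ q) ^ (1/q)
        ≤ ENNReal.ofReal (C * h ^ β)
          * eLpNorm (fun p : ℝ × ℝ => galleryMode Ai ω ψ k h 0 p.1 p.2) 2 μΩ := by
  have hq0 : 0 < q := by linarith
  refine ⟨1, one_pos, fun k _ h _ => ?_⟩
  simp [h0, hq0]

theorem hasDerivAt_re_airy {Ai : ℂ → ℂ} (hAi_diff : Differentiable ℂ Ai)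
    (hAi_diff' : Differentiable ℂ (deriv Ai))
    (hAi_ode : ∀ z : ℂ, deriv (deriv Ai) z = z * Ai z) :
    (∀ x : ℝ, HasDerivAt (fun x : ℝ => (Ai x).re) (deriv Ai x).re x) ∧
      ∀ x : ℝ, HasDerivAt (fun x : ℝ => (deriv Ai x).re) (x * (Ai x).re) x := by
  refine ⟨fun x => (hAi_diff x).hasDerivAt.real_of_complex, fun x => ?_⟩
  refine (hAi_diff' x).hasDerivAt.real_of_complex.congr_deriv ?_
  rw [hAi_ode, Complex.re_ofReal_mul]

theorem exists_one_le_ne_of_strictMonoOn {ω : ℕ → ℝ} (hω_mono : StrictMonoOn ω {k | 1 ≤ k})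
    (hω_tendsto : Tendsto ω atTop atTop) :
    ∃ s, 1 ≤ s ∧ ∀ k, 1 ≤ k → s ≠ ω k := by
  obtain ⟨n, hn, hn1⟩ := ((hω_tendsto.eventually_ge_atTop 1).and (eventually_ge_atTop 1)).exists
  have hlt : ω n < ω (n + 1) := hω_mono hn1 (Nat.le_add_left 1 n) (Nat.lt_succ_self n)
  refine ⟨(ω n + ω (n + 1)) / 2, by linarith, fun k hk he => ?_⟩
  rcases le_or_gt k n with hkn | hkn
  · have := hω_mono.monotoneOn hk hn1 hkn
    linarith
  · have := hω_mono.monotoneOn (Nat.le_add_left 1 n) hk (Nat.succ_le_of_lt hkn)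
    linarith

/-- gallery modes satisfy the free-space 2D Strichartz estimates,
with a constant uniform in the gallery-mode index `k`. -/
theorem gallery_mode_strichartz
    (Ai : ℂ → ℂ)
    (hAi_diff : Differentiable ℂ Ai)
    (hAi_diff' : Differentiable ℂ (deriv Ai))
    (hAi_ode : ∀ z : ℂ, deriv (deriv Ai) z = z * Ai z)
    (hAi_zero : Ai 0 = (3 : ℂ) ^ (-(2 : ℂ)/3) / Complex.Gamma (2/3))
    (hAi_zero' : deriv Ai 0 = -((3 : ℂ) ^ (-(1 : ℂ)/3)) / Complex.Gamma (1/3))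
    (hAi_real : ∀ x : ℝ, (Ai x).im = 0)
    (ω : ℕ → ℝ)
    (hω_pos : 0 < ω 1)
    (hω_mono : StrictMonoOn ω {k | 1 ≤ k})
    (hω_tendsto : Tendsto ω atTop atTop)
    (hAi_zeros : ∀ x : ℝ, Ai x = 0 ↔ ∃ k : ℕ, 1 ≤ k ∧ x = -ω k)
    (ψ : ℝ → ℝ) (hψ : ContDiff ℝ (⊤ : ℕ∞) ψ) (hψs : tsupport ψ ⊆ Set.Icc (1/2 : ℝ) (3/2))
    (q : ℝ) (hq : 4 ≤ q) (r : ℝ≥0∞) (hr : 2 ≤ r)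
    (hadm : 1/q = (1/2) * (1/2 - (r⁻¹).toReal)) :
    ∃ C > 0, ∀ k : ℕ, 1 ≤ k → ∀ h ∈ Set.Ioc (0:ℝ) 1,
      (∫⁻ t : ℝ,
          (eLpNorm (fun p : ℝ × ℝ => galleryMode Ai ω ψ k h t p.1 p.2) r μΩ) ^ q) ^ (1/q)
        ≤ ENNReal.ofReal (C * h ^ (-(2 * (1/2 - (r⁻¹).toReal) - 1/q)))
          * eLpNorm (fun p : ℝ × ℝ => galleryMode Ai ω ψ k h 0 p.1 p.2) 2 μΩ := by
  have hq0 : 0 < q := by linarith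
  obtain ⟨hA, hA'⟩ := hasDerivAt_re_airy hAi_diff hAi_diff' hAi_ode
  have hre : ∀ x : ℝ, (Ai x).re = 0 → Ai x = 0 := fun x hx =>
    Complex.ext hx (by simpa using hAi_real x)
  set A : ℝ → ℝ := fun x => (Ai x).re with hAdef
  have cA : Continuous A := continuous_iff_continuousAt.2 fun x => (hA x).continuousAt
  have hωge : ∀ k, 1 ≤ k → ω 1 ≤ ω k := fun k hk => hω_mono.monotoneOn (le_refl 1) hk hk
  have hiff : ∀ k, IntegrableOn (fun x' : ℝ => (Ai ((x' - ω k : ℝ))).re ^ 2) (Set.Ioi 0) ↔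
      IntegrableOn (fun x => A x ^ 2) (Set.Ioi 0) := fun k =>
    (integrableOn_Ioi_comp_sub_right_iff (f := fun x => A x ^ 2)).trans
      (integrableOn_Ioi_iff_of_continuous (cA.pow 2) _ _)
  by_cases hint : IntegrableOn (fun x => A x ^ 2) (Set.Ioi 0)
  swap
  · refine exists_strichartz_of_forall_eq_zero (fun k h t x y => ?_) hq r _
    have : ∫ x' in Set.Ioi (0:ℝ), (Ai ((x' - ω k : ℝ))).re ^ 2 = 0 :=
      integral_undef fun hi => hint ((hiff k).1 hi)
    simp only [galleryMode, ek, this]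
    simp
  by_cases hψ0 : ψ = 0
  · exact exists_strichartz_of_forall_eq_zero (fun k h t x y => by simp [galleryMode, hψ0]) hq r _
  have hP : 0 < ∫ η, ψ η ^ 2 := by
    obtain ⟨η, hη⟩ := Function.ne_iff.1 hψ0
    have hcs : HasCompactSupport ψ := HasCompactSupport.of_support_subset_isCompact isCompact_Icc
      ((subset_tsupport ψ).trans hψs)
    exact (hψ.continuous.pow 2).integral_pos_of_hasCompactSupport_nonneg_nonzero
      (hcs.mono fun η hη hη0 => hη (by simp [hη0])) (fun η => sq_nonneg _)
      (pow_ne_zero 2 hη)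
  have hne : ∀ x, 0 ≤ x → A x ≠ 0 := fun x hx h0 => by
    obtain ⟨k, hk, rfl⟩ := (hAi_zeros x).1 (hre x h0)
    linarith [hωge k hk]
  have hne' : ∃ s, 1 ≤ s ∧ A (-s) ≠ 0 := by
    obtain ⟨s, hs, hsω⟩ := exists_one_le_ne_of_strictMonoOn hω_mono hω_tendsto
    refine ⟨s, hs, fun h0 => ?_⟩
    obtain ⟨k, hk, he⟩ := (hAi_zeros (-s)).1 (hre (-s) h0)
    exact hsω k hk (neg_injective he)
  obtain ⟨C, hC, hCA, hvar, hmass⟩ := airy_uniform_bounds hA hA' hne hne' hint hω_pos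
  have cA' : Continuous fun x : ℝ => (deriv Ai x).re :=
    continuous_iff_continuousAt.2 fun x => (hA' x).continuousAt
  obtain ⟨K, hK, hdecay⟩ := gallery_oscillatory_decay hA cA' hω_pos hC hCA hvar hψ
  have hpi := Real.pi_pos
  set V := 2 * π * ∫ η, ψ η ^ 2 with hV
  have hV0 : 0 < V := by positivity
  refine ⟨(π * K * C ^ 2 / V ^ 2) ^ (1 / q), by positivity, fun k hk h hh => ?_⟩
  have hωk : 0 < ω k := hω_pos.trans_le (hωge k hk)
  have hzero : A (-ω k) = 0 := by
    rw [hAdef]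
    simp only
    rw [(hAi_zeros (-ω k)).2 ⟨k, hk, rfl⟩, Complex.zero_re]
  set J := ∫ x' in Set.Ioi (0:ℝ), (Ai ((x' - ω k : ℝ))).re ^ 2 with hJ
  have hJC : √(ω k) ≤ C * J := by
    rw [hJ, integral_Ioi_comp_sub_right (fun x => A x ^ 2)]
    exact hmass (ω k) (hωge k hk) hzero
  have hJ0 : 0 < J := pos_of_mul_pos_right ((Real.sqrt_pos.2 hωk).trans_le hJC) hC.le
  have hT : 0 < ω k * h ^ ((1:ℝ)/3) := mul_pos hωk (Real.rpow_pos_of_pos hh.1 _)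
  have h2 := eLpNorm_galleryMode_two hAi_diff hAi_real hωk ((hiff k).2 hint) hJ0 hψ hψs hh.1
  set M := h⁻¹ ^ 4 * (h ^ ((4:ℝ)/3))⁻¹ * J⁻¹ ^ 2 * K with hM
  have hM0 : 0 ≤ M := by
    have := hh.1
    positivity
  have hpt : ∀ t : ℝ, ∀ᵐ p ∂μΩ, ‖galleryMode Ai ω ψ k h t p.1 p.2‖ₑ ^ 4 ≤
      ENNReal.ofReal (M * (1 + (t / (ω k * h ^ ((1:ℝ)/3))) ^ 2)⁻¹) := fun t => by
    filter_upwards [ae_restrict_mem (measurableSet_Ioi.prod MeasurableSet.univ)] with p hp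
    rw [hM, mul_assoc _ K]
    exact enorm_galleryMode_pow_four_le hAi_real hψs hh.1
      (fun X hX y => hdecay (ω k) (hωge k hk) h hh X hX t y) hp.1 p.2
  have hL := lintegral_eLpNorm_rpow_le
    (u := fun t p => galleryMode Ai ω ψ k h t p.1 p.2) (μ := μΩ)
    (fun t => (stronglyMeasurable_galleryMode hAi_diff.continuous ω hψ.continuous k h
      t).aestronglyMeasurable) (by fun_prop) hpt (fun t => (h2 t).trans (h2 0).symm) hq hr hadm
  rw [lintegral_const_mul_inv_one_add_div_sq hM0 hT] at hL
  refine mixed_norm_bound_of_lintegral_le (by positivity) hV0 hh.1 hq ?_ ?_ (hL.trans ?_)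
  · have : 1 / 2 - (r⁻¹).toReal = 2 * (1 / q) := by linarith
    rw [this]
    ring
  · rw [h2 0, hV]
    congr 2
    ring
  · exact mul_le_mul' (ENNReal.ofReal_le_ofReal (decay_constant_le hC hK hωk hh.1 hJC)) le_rfl
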